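/- arXiv:math/0406133 — 3 statements merged into one kernel-verified Lean document; each statement's English description precedes it below -/
import Mathlib

section
/- (Wadsworth) Let q and q′ be nondegenerate quadratic forms of rank 4 over a field k of characteristic ≠ 2, with q anisotropic. If the function fields k(q) and k(q′) are isomorphic as k-algebras, then q and q′ are similar. -/
open scoped TensorProduct
open Quaternion
set_option synthInstance.maxHeartbeats 1000000
set_option maxHeartbeats 1000000
noncomputable section

universe u v

/-- Upper-triangular coefficient matrix of a quadratic form on `Fin n → R`. -/
def coeffMatrix {R : Type*} [CommRing R] {n : ℕ} (q : QuadraticForm R (Fin n → R)) :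
    Matrix (Fin n) (Fin n) R :=
  Matrix.of fun i j =>
    if i = j then q (Pi.single i 1)
    else if i < j then QuadraticMap.polar q (Pi.single i 1) (Pi.single j 1)
    else 0

/-- Base change of a quadratic form on `Fin n → R` along `R → l`. -/
def extendQF {R : Type*} [CommRing R] {n : ℕ} (q : QuadraticForm R (Fin n → R))
    (l : Type*) [CommRing l] [Algebra R l] : QuadraticForm l (Fin n → l) :=
  ((coeffMatrix q).map (algebraMap R l)).toQuadraticMap'

/-- Gram matrix of the polar bilinear form of `q`. -/
def polarMatrix {R : Type*} [CommRing R] {n : ℕ} (q : QuadraticForm R (Fin n → R)) :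
    Matrix (Fin n) (Fin n) R :=
  Matrix.of fun i j => QuadraticMap.polar q (Pi.single i 1) (Pi.single j 1)

/-- Discriminant: determinant of the Gram matrix (well defined up to squares). -/
def discQF {R : Type*} [CommRing R] {n : ℕ} (q : QuadraticForm R (Fin n → R)) : R :=
  (polarMatrix q).det

/-- Nondegeneracy (char ≠ 2): the Gram determinant is nonzero. -/
def NondegQF {R : Type*} [CommRing R] {n : ℕ} (q : QuadraticForm R (Fin n → R)) : Prop :=
  discQF q ≠ 0

/-- Two quadratic forms are similar if one is isometric to a unit scaling of the other. -/
def SimilarQF {R : Type*} [CommRing R] {n : ℕ} (q q' : QuadraticForm R (Fin n → R)) : Prop :=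
  ∃ c : R, IsUnit c ∧ QuadraticMap.Equivalent (c • q) q'

/-- The polynomial `q(X₁, …, X_{n-1}, 1)` defining the affine quadric. -/
def affineQuadricPoly {R : Type*} [CommRing R] {n : ℕ} (q : QuadraticForm R (Fin n → R)) :
    MvPolynomial (Fin (n - 1)) R :=
  (extendQF q (MvPolynomial (Fin (n - 1)) R))
    (fun i => if h : (i : ℕ) < n - 1 then MvPolynomial.X ⟨i, h⟩ else 1)

/-- Affine coordinate ring `R[x₁,…,x_{n-1}]/(q(x₁,…,x_{n-1},1))` of the quadric. -/
abbrev quadricCoordRing {R : Type*} [CommRing R] {n : ℕ}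
    (q : QuadraticForm R (Fin n → R)) : Type _ :=
  MvPolynomial (Fin (n - 1)) R ⧸ Ideal.span {affineQuadricPoly q}

/-- Function field `k(q)` of the quadric hypersurface `q = 0`. -/
abbrev quadricFunctionField {R : Type*} [CommRing R] {n : ℕ}
    (q : QuadraticForm R (Fin n → R)) : Type _ :=
  FractionRing (quadricCoordRing q)

/-- Affine coordinate ring `k[x,y]/(ax²+by²-1)` of the conic `C_{a,b}`. -/
abbrev conicCoordRing (k : Type*) [Field k] (a b : k) : Type _ :=
  MvPolynomial (Fin 2) k ⧸
    Ideal.span {(MvPolynomial.C a * MvPolynomial.X 0 ^ 2 +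
      MvPolynomial.C b * MvPolynomial.X 1 ^ 2 - 1 : MvPolynomial (Fin 2) k)}

/-- The conic function field `k(C_{a,b})`. -/
abbrev conicFunctionField (k : Type*) [Field k] (a b : k) : Type _ :=
  FractionRing (conicCoordRing k a b)

/-- A `k`-algebra is split if it is isomorphic to a matrix algebra over `k`. -/
def IsSplitAlg (k A : Type*) [Field k] [Ring A] [Algebra k A] : Prop :=
  ∃ n : ℕ, 0 < n ∧ Nonempty (A ≃ₐ[k] Matrix (Fin n) (Fin n) k)

/-- `A` is split by the extension `K/k`: the class of `A` lies in the Brauer kernel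
`κ(K/k) = ker (Br k → Br K)`. -/
def SplitsIn (k : Type*) [Field k] (A : Type*) [Ring A] [Algebra k A]
    (K : Type*) [CommRing K] [Algebra k K] : Prop :=
  ∃ n : ℕ, 0 < n ∧ Nonempty ((K ⊗[k] A) ≃ₐ[K] Matrix (Fin n) (Fin n) K)

/-- Brauer equivalence of two `k`-algebras. -/
def BrauerEquiv (k A B : Type*) [Field k] [Ring A] [Algebra k A] [Ring B] [Algebra k B] :
    Prop :=
  ∃ n m : ℕ, 0 < n ∧ 0 < m ∧
    Nonempty (Matrix (Fin n) (Fin n) A ≃ₐ[k] Matrix (Fin m) (Fin m) B)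

/-- A field is finitely generated (over its prime subfield). -/
def FieldFG (K : Type*) [Field K] : Prop :=
  ∃ s : Finset K, Subfield.closure (s : Set K) = ⊤

/-- Elementary equivalence in the first-order language of rings. -/
def ElemEquivRing (K₁ : Type*) (K₂ : Type*) [CommRing K₁] [CommRing K₂] : Prop :=
  letI := FirstOrder.Ring.compatibleRingOfRing K₁
  letI := FirstOrder.Ring.compatibleRingOfRing K₂
  FirstOrder.Language.ring.ElementarilyEquivalent K₁ K₂

/-- The `m`-fold Pfister form `⟨⟨a₁,…,aₘ⟩⟩ = ⟨1,a₁⟩ ⊗ ⋯ ⊗ ⟨1,aₘ⟩`. -/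
def pfisterForm {k : Type*} [Field k] {m : ℕ} (a : Fin m → k) :
    QuadraticForm k (Fin (2 ^ m) → k) :=
  QuadraticMap.weightedSumSquares k
    (fun j : Fin (2 ^ m) => ∏ i : Fin m, if Nat.testBit (j : ℕ) (i : ℕ) then a i else 1)

/-- The diagonal quadratic form `∑ wᵢ xᵢ²`. -/
def diagQ {R ι : Type*} [CommRing R] [Fintype ι] (w x : ι → R) : R := ∑ i, w i * x i ^ 2

/-- The bilinear form `∑ wᵢ xᵢ yᵢ` attached to `diagQ w`. -/
def diagB {R ι : Type*} [CommRing R] [Fintype ι] (w x y : ι → R) : R := ∑ i, w i * (x i * y i)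

/-- Anisotropy of a diagonal quadratic form. -/
def DiagAniso {R ι : Type*} [CommRing R] [Fintype ι] (w : ι → R) : Prop :=
  ∀ x, diagQ w x = 0 → x = 0

section Diag

variable {R S ι : Type*} [CommRing R] [CommRing S] [Fintype ι]

theorem diagQ_lin (w x y : ι → R) (a b : R) :
    diagQ w (fun i => a * x i + b * y i) =
      a ^ 2 * diagQ w x + 2 * a * b * diagB w x y + b ^ 2 * diagQ w y := by
  simp only [diagQ, diagB, Finset.mul_sum, ← Finset.sum_add_distrib]
  exact Finset.sum_congr rfl fun i _ => by ring

theorem diagB_lin (w x y z : ι → R) (a b : R) :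
    diagB w x (fun i => a * y i + b * z i) = a * diagB w x y + b * diagB w x z := by
  simp only [diagB, Finset.mul_sum, ← Finset.sum_add_distrib]
  exact Finset.sum_congr rfl fun i _ => by ring

theorem diagB_comm (w x y : ι → R) : diagB w x y = diagB w y x := by
  simp only [diagB, mul_comm]

theorem diagB_self (w x : ι → R) : diagB w x x = diagQ w x := by
  simp only [diagB, diagQ, sq]

theorem map_diagQ (f : R →+* S) (w x : ι → R) :
    f (diagQ w x) = diagQ (fun i => f (w i)) (fun i => f (x i)) := by
  simp [diagQ]

theorem map_diagB (f : R →+* S) (w x y : ι → R) :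
    f (diagB w x y) = diagB (fun i => f (w i)) (fun i => f (x i)) (fun i => f (y i)) := by
  simp [diagB]

theorem diagQ_mul (w x : ι → R) (a : R) :
    diagQ w (fun i => a * x i) = a ^ 2 * diagQ w x := by
  simpa using diagQ_lin w x x a 0

end Diag

section CasselsPfister

open Polynomial

variable {E ι : Type*} [Field E] [Fintype ι]

theorem coeff_diagQ_top (w : ι → E) (P : ι → E[X]) (n : ℕ) (hP : ∀ i, (P i).natDegree ≤ n) :
    (diagQ (fun i => C (w i)) P).coeff (2 * n) = diagQ w (fun i => (P i).coeff n) := by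
  simp only [diagQ, finsetSum_coeff, coeff_C_mul]
  exact Finset.sum_congr rfl fun i _ => by rw [coeff_pow_of_natDegree_le (hP i)]

/-- For an anisotropic form leading terms cannot cancel. -/
theorem DiagAniso.natDegree_le {w : ι → E} (hw : DiagAniso w) (P : ι → E[X]) (m : ℕ)
    (h : (diagQ (fun i => C (w i)) P).natDegree ≤ 2 * m) (i : ι) : (P i).natDegree ≤ m := by
  have key : ∀ n, (∀ i, (P i).natDegree ≤ m + n) → ∀ i, (P i).natDegree ≤ m := by
    intro n
    induction n with
    | zero => exact fun h => h
    | succ n ih =>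
      intro hn
      refine ih fun i => ?_
      have h0 := coeff_diagQ_top w P _ hn
      rw [coeff_eq_zero_of_natDegree_lt (by omega)] at h0
      have h1 := congrFun (hw _ h0.symm) i
      have h2 := hn i
      by_contra hc
      have h3 : (P i).natDegree = m + (n + 1) := by omega
      have h4 : (P i).leadingCoeff = 0 := by rw [leadingCoeff, h3]; exact h1
      rw [leadingCoeff_eq_zero] at h4
      simp [h4] at h3
  refine key (Finset.univ.sup fun i => (P i).natDegree) (fun i => ?_) i
  exact (Finset.le_sup (f := fun i => (P i).natDegree) (Finset.mem_univ i)).trans (by omega)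

theorem DiagAniso.polynomial {w : ι → E} (hw : DiagAniso w) :
    DiagAniso (fun i => (C (w i) : E[X])) := by
  intro P hP
  have h := hw.natDegree_le P 0 (by simp [hP])
  have h1 : ∀ i, P i = C ((P i).coeff 0) := fun i => eq_C_of_natDegree_le_zero (h i)
  have h2 : diagQ w (fun i => (P i).coeff 0) = 0 := by
    have := coeff_diagQ_top w P 0 h
    rw [← this, hP]; simp
  funext i
  rw [h1 i, congrFun (hw _ h2) i]
  simp

theorem diagQ_linear_coeffs (w v u : ι → E) (a b c : E)
    (h : diagQ (fun i => C (w i)) (fun i => C (v i) * X + C (u i)) =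
      C a * X ^ 2 + C b * X + C c) :
    diagQ w v = a ∧ 2 * diagB w v u = b ∧ diagQ w u = c := by
  have h1 : diagQ (fun i => C (w i)) (fun i => C (v i) * X + C (u i)) =
      C (diagQ w v) * X ^ 2 + C (2 * diagB w v u) * X + C (diagQ w u) := by
    have := diagQ_lin (fun i => C (w i)) (fun i => C (v i)) (fun i => C (u i)) X 1
    simp only [← map_diagQ, ← map_diagB] at this
    rw [show (fun i => C (v i) * X + C (u i)) = (fun i => X * C (v i) + 1 * C (u i)) by
      funext i; ring, this]
    simp only [map_mul, map_ofNat]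
    ring
  rw [h1] at h
  refine ⟨?_, ?_, ?_⟩
  · simpa [coeff_X, coeff_C] using congrArg (fun p => coeff p 2) h
  · simpa [coeff_X, coeff_C] using congrArg (fun p => coeff p 1) h
  · simpa [coeff_X, coeff_C] using congrArg (fun p => coeff p 0) h

/-- Cassels–Pfister, with denominators cleared, preserving one linear constraint. -/
theorem casselsPfister_aux {w : ι → E} (hw : DiagAniso w) (c : ι → E) (f : E[X]) (n : ℕ) :
    ∀ (r : E[X]) (P : ι → E[X]), r.natDegree ≤ n → r ≠ 0 →
      diagQ (fun i => C (w i)) P = f * r ^ 2 → ∑ i, C (c i) * P i = 0 →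
      ∃ P' : ι → E[X], diagQ (fun i => C (w i)) P' = f ∧ ∑ i, C (c i) * P' i = 0 := by
  induction n with
  | zero =>
    intro r P hr hr0 hP hc
    obtain ⟨e, rfl⟩ : ∃ e, r = C e := ⟨_, eq_C_of_natDegree_le_zero hr⟩
    have he : e ≠ 0 := by rintro rfl; simp at hr0
    have hee : C e⁻¹ * C e = (1 : E[X]) := by rw [← C_mul, inv_mul_cancel₀ he, C_1]
    refine ⟨fun i => C e⁻¹ * P i, ?_, ?_⟩
    · rw [diagQ_mul, hP]
      linear_combination f * (C e⁻¹ * C e + 1) * hee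
    · rw [← mul_zero (C e⁻¹), ← hc, Finset.mul_sum]
      exact Finset.sum_congr rfl fun i _ => by ring
  | succ n ih =>
    intro r P hr hr0 hP hc
    by_cases hrn : r.natDegree ≤ n
    · exact ih r P hrn hr0 hP hc
    have hrd : r.natDegree = n + 1 := by omega
    set s : ι → E[X] := fun i => P i / r with hs
    set t : ι → E[X] := fun i => P i % r with ht
    have hst : ∀ i, P i = r * s i + t i := fun i => (EuclideanDomain.div_add_mod (P i) r).symm
    have htd : ∀ i, (t i).natDegree ≤ n := by
      intro i
      have := natDegree_mod_lt (P i) (q := r) (by omega)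
      simp only [ht]; omega
    have hcs : ∑ i, C (c i) * s i = 0 := by
      have h1 : r * ∑ i, C (c i) * s i = -∑ i, C (c i) * t i := by
        rw [eq_neg_iff_add_eq_zero, ← hc, Finset.mul_sum, ← Finset.sum_add_distrib]
        exact Finset.sum_congr rfl fun i _ => by rw [hst i]; ring
      by_contra hne
      have h2 : (r * ∑ i, C (c i) * s i).natDegree ≤ n := by
        rw [h1, natDegree_neg]
        exact natDegree_sum_le_of_forall_le _ _ fun i _ => (natDegree_C_mul_le _ _).trans (htd i)
      rw [natDegree_mul hr0 hne] at h2
      omega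
    by_cases ht0 : t = 0
    · refine ⟨s, ?_, hcs⟩
      have h1 : P = fun i => r * s i := by
        funext i; rw [hst i, congrFun ht0 i]; simp
      rw [h1, diagQ_mul] at hP
      exact mul_left_cancel₀ (pow_ne_zero 2 hr0) (by rw [hP]; ring)
    set W : ι → E[X] := fun i => C (w i) with hW
    set a := diagQ W s - f with ha
    set b := 2 * (f * r - diagB W P s) with hb
    have hr' : r * (a * r + b) = diagQ W t := by
      have h1 : t = fun i => 1 * P i + (-r) * s i := by funext i; rw [hst i]; ring
      rw [h1, diagQ_lin, hP, ha, hb]; ring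
    have hq0 : diagQ W t ≠ 0 := fun h => ht0 (hw.polynomial _ h)
    have hr'0 : a * r + b ≠ 0 := by
      intro h; rw [h, mul_zero] at hr'; exact hq0 hr'.symm
    refine ih (a * r + b) (fun i => a * P i + b * s i) ?_ hr'0 ?_ ?_
    · have h1 : (diagQ W t).natDegree ≤ 2 * n := by
        refine natDegree_sum_le_of_forall_le _ _ fun i _ => (natDegree_C_mul_le _ _).trans ?_
        exact (natDegree_pow_le).trans (Nat.mul_le_mul_left _ (htd i))
      rw [← hr', natDegree_mul hr0 hr'0] at h1
      omega
    · rw [diagQ_lin, hP, hb]; simp only [ha]; ring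
    · calc ∑ i, C (c i) * (a * P i + b * s i)
          = a * ∑ i, C (c i) * P i + b * ∑ i, C (c i) * s i := by
            simp only [Finset.mul_sum, ← Finset.sum_add_distrib]
            exact Finset.sum_congr rfl fun i _ => by ring
        _ = 0 := by rw [hc, hcs]; ring

variable {K : Type*} [Field K] [Algebra E[X] K] [IsFractionRing E[X] K]


theorem exists_common_denominator (x : ι → K) :
    ∃ (r : E[X]) (P : ι → E[X]), r ≠ 0 ∧
      ∀ i, algebraMap E[X] K (P i) = algebraMap E[X] K r * x i := by
  obtain ⟨b, hb⟩ := IsLocalization.exist_integer_multiples_of_finite (nonZeroDivisors E[X]) x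
  choose P hP using hb
  exact ⟨b, P, nonZeroDivisors.ne_zero b.2, fun i => by rw [hP i, Algebra.smul_def]⟩

/-- An anisotropic form stays anisotropic over a rational function field. -/
theorem DiagAniso.fractionRing {w : ι → E} (hw : DiagAniso w) :
    DiagAniso (fun i => algebraMap E[X] K (C (w i))) := by
  intro x hx
  obtain ⟨r, P, hr, hP⟩ := exists_common_denominator (E := E) x
  have hr' : algebraMap E[X] K r ≠ 0 := by simpa using hr
  have h1 : diagQ (fun i => (C (w i) : E[X])) P = 0 := by
    apply IsFractionRing.injective E[X] K
    rw [map_diagQ, map_zero]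
    simp only [hP]
    rw [diagQ_mul, hx, mul_zero]
  have h2 := hw.polynomial _ h1
  funext i
  have := hP i
  rw [congrFun h2 i] at this
  simpa [hr'] using this

/-- The Cassels–Pfister theorem, preserving one linear constraint. -/
theorem casselsPfister {w : ι → E} (hw : DiagAniso w) (c : ι → E) (f : E[X]) (x : ι → K)
    (hx : diagQ (fun i => algebraMap E[X] K (C (w i))) x = algebraMap E[X] K f)
    (hc : ∑ i, algebraMap E[X] K (C (c i)) * x i = 0) :
    ∃ P : ι → E[X], diagQ (fun i => C (w i)) P = f ∧ ∑ i, C (c i) * P i = 0 := by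
  obtain ⟨r, P, hr, hP⟩ := exists_common_denominator (E := E) x
  refine casselsPfister_aux hw c f r.natDegree r P le_rfl hr ?_ ?_
  · apply IsFractionRing.injective E[X] K
    rw [map_diagQ]
    simp only [hP]
    rw [diagQ_mul, hx, map_mul, map_pow, mul_comm]
  · apply IsFractionRing.injective E[X] K
    rw [map_sum, map_zero, ← mul_zero (algebraMap E[X] K r), ← hc, Finset.mul_sum]
    exact Finset.sum_congr rfl fun i _ => by rw [map_mul, hP]; ring

end CasselsPfister

/-- Over an anisotropic form a reflection moves `v₁` to any vector `v` of the same length. -/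
theorem exists_reflected {E ι : Type*} [Field E] [Fintype ι] {w : ι → E} (hw : DiagAniso w)
    (v₁ v v₀ : ι → E) (h : diagQ w v₁ = diagQ w v) (h0 : diagB w v₁ v₀ = 0) :
    ∃ v₀', diagQ w v₀' = diagQ w v₀ ∧ diagB w v v₀' = 0 := by
  by_cases hv : v₁ = v
  · exact ⟨v₀, rfl, hv ▸ h0⟩
  set u : ι → E := fun i => 1 * v₁ i + (-1) * v i with hu
  have hu0 : diagQ w u ≠ 0 := by
    intro hc
    apply hv
    funext i
    have := congrFun (hw _ hc) i
    simp only [hu, Pi.zero_apply] at this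
    linear_combination this
  have e1 : diagQ w u = 2 * diagQ w v - 2 * diagB w v₁ v := by rw [hu, diagQ_lin, h]; ring
  have e2 : diagB w v₀ u = -diagB w v v₀ := by
    rw [hu, diagB_lin, diagB_comm w v₀ v₁, h0, diagB_comm w v₀ v]; ring
  have e3 : diagB w v u = diagB w v₁ v - diagQ w v := by
    rw [hu, diagB_lin, diagB_comm w v v₁, diagB_self]; ring
  refine ⟨fun i => 1 * v₀ i + (-(2 * diagB w v₀ u / diagQ w u)) * u i, ?_, ?_⟩
  · rw [diagQ_lin]; field_simp; ring
  · rw [diagB_lin]; field_simp; rw [e2, e3, e1]; ring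

section Pfister

open Polynomial

variable {F : Type*} [Field F]

theorem natDegree_X_sq_add_C (c : F) : (X ^ 2 + C c : F[X]).natDegree = 2 :=
  natDegree_X_pow_add_C

theorem monic_X_sq_add_C {R : Type*} [CommRing R] (c : R) : (X ^ 2 + C c : R[X]).Monic :=
  monic_X_pow_add_C c two_ne_zero

theorem eq_zero_of_quadratic_dvd_linear {c u w : F} (h : X ^ 2 + C c ∣ C u * X + C w) :
    u = 0 ∧ w = 0 := by
  have h0 : C u * X + C w = 0 := by
    refine eq_zero_of_dvd_of_natDegree_lt h ?_
    rw [natDegree_X_sq_add_C]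
    exact lt_of_le_of_lt natDegree_linear_le one_lt_two
  constructor
  · simpa using congrArg (fun p => coeff p 1) h0
  · simpa using congrArg (fun p => coeff p 0) h0

/-- If `X² + c` divides a value of an anisotropic form `⟨1, A, B, ABs²⟩` at a vector which is
nonzero modulo `X² + c`, then `⟨A, B, AB⟩` represents `c`. -/
theorem pure_represents_of_dvd (c A B s : F) (p : Fin 4 → F[X])
    (han : DiagAniso ![1, A, B, A * B]) (hs : s ≠ 0) (h2 : (2 : F) ≠ 0)
    (hdvd : X ^ 2 + C c ∣
      p 0 ^ 2 + C A * p 1 ^ 2 + C B * p 2 ^ 2 + C (A * B * s ^ 2) * p 3 ^ 2)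
    (hnd : ¬ X ^ 2 + C c ∣ p 3) :
    ∃ Q : Fin 3 → F, diagQ ![A, B, A * B] Q = c := by
  have hm := monic_X_sq_add_C c
  have hlin : ∀ i, ∃ u w : F, ∃ g : F[X], p i = (X ^ 2 + C c) * g + (C u * X + C w) := by
    intro i
    have hd : (p i %ₘ (X ^ 2 + C c)).natDegree ≤ 1 := by
      have := natDegree_modByMonic_lt (p i) hm (by
        intro h
        have := congrArg natDegree h
        rw [natDegree_X_sq_add_C] at this
        simp at this)
      rw [natDegree_X_sq_add_C] at this
      omega
    obtain ⟨u, w, h⟩ := exists_eq_X_add_C_of_natDegree_le_one hd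
    exact ⟨u, w, p i /ₘ (X ^ 2 + C c), by rw [← h, add_comm, modByMonic_add_div]⟩
  choose u w g hg using hlin
  have h3 : u 3 ≠ 0 ∨ w 3 ≠ 0 := by
    by_contra hc
    push Not at hc
    apply hnd
    rw [hg 3, hc.1, hc.2]
    simp
  set Nu := u 0 ^ 2 + A * u 1 ^ 2 + B * u 2 ^ 2 + A * B * s ^ 2 * u 3 ^ 2 with hNu
  set Nw := w 0 ^ 2 + A * w 1 ^ 2 + B * w 2 ^ 2 + A * B * s ^ 2 * w 3 ^ 2 with hNw
  set Bu := u 0 * w 0 + A * (u 1 * w 1) + B * (u 2 * w 2) + A * B * s ^ 2 * (u 3 * w 3) with hBu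
  have hd1 : X ^ 2 + C c ∣ C (2 * Bu) * X + C (Nw - c * Nu) := by
    have h1 : C (2 * Bu) * X + C (Nw - c * Nu) =
        (p 0 ^ 2 + C A * p 1 ^ 2 + C B * p 2 ^ 2 + C (A * B * s ^ 2) * p 3 ^ 2) -
        (X ^ 2 + C c) * (C Nu +
          (X ^ 2 + C c) * (g 0 ^ 2 + C A * g 1 ^ 2 + C B * g 2 ^ 2 + C (A * B * s ^ 2) * g 3 ^ 2)
          + 2 * (g 0 * (C (u 0) * X + C (w 0)) + C A * (g 1 * (C (u 1) * X + C (w 1)))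
            + C B * (g 2 * (C (u 2) * X + C (w 2)))
            + C (A * B * s ^ 2) * (g 3 * (C (u 3) * X + C (w 3))))) := by
      rw [hg 0, hg 1, hg 2, hg 3, hNu, hNw, hBu]
      simp only [map_add, map_mul, map_sub, map_pow, map_ofNat]
      ring
    rw [h1]
    exact dvd_sub hdvd (dvd_mul_right _ _)
  obtain ⟨hB0, hN0⟩ := eq_zero_of_quadratic_dvd_linear hd1
  have hB0 : Bu = 0 := by simpa [h2] using hB0
  have haniso : ∀ x : Fin 4 → F,
      x 0 ^ 2 + A * x 1 ^ 2 + B * x 2 ^ 2 + A * B * s ^ 2 * x 3 ^ 2 = 0 → x 3 = 0 := by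
    intro x hx
    have := congrFun (han ![x 0, x 1, x 2, s * x 3] (by
      simp only [diagQ, Fin.sum_univ_four, Matrix.cons_val]; linear_combination hx)) 3
    simpa [hs] using this
  have hNu0 : Nu ≠ 0 := by
    intro hz
    have e1 := haniso u hz
    have e2 := haniso w (by rw [← hNw]; linear_combination hN0 + c * hz)
    simp [e1, e2] at h3
  refine ⟨![(u 0 * w 1 - u 1 * w 0 + B * s * (u 3 * w 2 - u 2 * w 3)) / Nu,
    (u 0 * w 2 - u 2 * w 0 + A * s * (u 1 * w 3 - u 3 * w 1)) / Nu,
    (s * (u 0 * w 3 - u 3 * w 0) + (u 2 * w 1 - u 1 * w 2)) / Nu], ?_⟩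
  simp only [diagQ, Fin.sum_univ_three, Matrix.cons_val]
  field_simp
  rw [show Nu ^ 2 * c = Nu * Nw - Bu ^ 2 by rw [hB0]; linear_combination (-Nu) * hN0]
  rw [hNu, hNw, hBu]
  ring

end Pfister

section Embedding

variable {k L : Type*} [Field k] [Field L] {n : ℕ}

/-- Extension of an embedding of a polynomial ring in `n` variables to `n + 1` variables, the new
variable going to the generator of a rational function field. -/
def ratFuncEmb (j : MvPolynomial (Fin n) k →+* L) : MvPolynomial (Fin (n + 1)) k →+* RatFunc L :=
  (algebraMap (Polynomial L) (RatFunc L)).comp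
    ((Polynomial.mapRingHom j).comp (MvPolynomial.finSuccEquiv k n : _ →+* _))

theorem ratFuncEmb_injective (j : MvPolynomial (Fin n) k →+* L) (hj : Function.Injective j) :
    Function.Injective (ratFuncEmb j) := by
  refine (IsFractionRing.injective (Polynomial L) (RatFunc L)).comp
    ((Polynomial.map_injective j hj).comp (MvPolynomial.finSuccEquiv k n).injective)

theorem ratFuncEmb_C (j : MvPolynomial (Fin n) k →+* L) (a : k) :
    ratFuncEmb j (MvPolynomial.C a) =
      algebraMap (Polynomial L) (RatFunc L) (Polynomial.C (j (MvPolynomial.C a))) := by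
  simp [ratFuncEmb, MvPolynomial.finSuccEquiv_apply]

theorem ratFuncEmb_X_zero (j : MvPolynomial (Fin n) k →+* L) :
    ratFuncEmb j (MvPolynomial.X 0) = algebraMap (Polynomial L) (RatFunc L) Polynomial.X := by
  simp [ratFuncEmb, MvPolynomial.finSuccEquiv_X_zero]

theorem ratFuncEmb_X_succ (j : MvPolynomial (Fin n) k →+* L) (i : Fin n) :
    ratFuncEmb j (MvPolynomial.X i.succ) =
      algebraMap (Polynomial L) (RatFunc L) (Polynomial.C (j (MvPolynomial.X i))) := by
  simp [ratFuncEmb, MvPolynomial.finSuccEquiv_X_succ]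

end Embedding

section Subform

open Polynomial

variable {L : Type*} [Field L]

/-- If an anisotropic form represents `a x² + h(y)` over `L(y)(x)`, it represents `a` over `L` and
`h` by linear polynomials orthogonal to the vector representing `a`. -/
theorem subform_of_represents {ι : Type*} [Fintype ι] {w : ι → L} (hw : DiagAniso w)
    (h2 : (2 : L) ≠ 0) (a α β γ : L) (Q : ι → RatFunc (RatFunc L))
    (hQ : diagQ (fun i => algebraMap (RatFunc L)[X] (RatFunc (RatFunc L))
        (C (algebraMap L[X] (RatFunc L) (C (w i))))) Q =
      algebraMap (RatFunc L)[X] (RatFunc (RatFunc L))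
        (C (algebraMap L[X] (RatFunc L) (C a)) * X ^ 2 +
          C (algebraMap L[X] (RatFunc L) (C α * X ^ 2 + C (2 * β) * X + C γ)))) :
    ∃ v p₁ p₀ : ι → L, diagQ w v = a ∧ diagQ w p₁ = α ∧ diagQ w p₀ = γ ∧
      diagB w v p₁ = 0 ∧ diagB w v p₀ = 0 ∧ diagB w p₁ p₀ = β := by
  have hwE : DiagAniso (fun i => algebraMap L[X] (RatFunc L) (C (w i))) := hw.fractionRing
  have h2E : (2 : RatFunc L) ≠ 0 := by
    have := (algebraMap L (RatFunc L)).injective.ne h2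
    rwa [map_ofNat, map_zero] at this
  obtain ⟨R, hR, -⟩ := casselsPfister hwE 0 _ Q hQ (by simp)
  have hRd := hwE.natDegree_le R 1 (by
    rw [hR]
    refine (natDegree_add_le _ _).trans (max_le ?_ ?_)
    · exact natDegree_C_mul_X_pow_le _ _
    · exact (natDegree_C _).le.trans (by omega))
  have hlin : ∀ i, ∃ s t, R i = C s * X + C t :=
    fun i => exists_eq_X_add_C_of_natDegree_le_one (hRd i)
  choose v₁ v₀ hv using hlin
  rw [show R = fun i => C (v₁ i) * X + C (v₀ i) from funext hv] at hR
  obtain ⟨e1, e2, e3⟩ := diagQ_linear_coeffs _ v₁ v₀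
    (algebraMap L[X] (RatFunc L) (C a)) 0
    (algebraMap L[X] (RatFunc L) (C α * X ^ 2 + C (2 * β) * X + C γ))
    (by rw [hR]; simp only [C_0, zero_mul, add_zero])
  have e2 := (mul_eq_zero.mp e2).resolve_left h2E
  obtain ⟨V, hV, -⟩ := casselsPfister hw 0 (C a) v₁ e1 (by simp)
  have hVd := hw.natDegree_le V 0 (by rw [hV]; simp)
  set v : ι → L := fun i => (V i).coeff 0 with hvdef
  have hVv : V = fun i => C (v i) := funext fun i => eq_C_of_natDegree_le_zero (hVd i)
  have hva : diagQ w v = a := by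
    rw [hVv, ← map_diagQ] at hV
    exact C_injective hV
  obtain ⟨v₀', e4, e5⟩ := exists_reflected hwE v₁
    (fun i => algebraMap L[X] (RatFunc L) (C (v i))) v₀ (by
      have := map_diagQ ((algebraMap L[X] (RatFunc L)).comp C) w v
      simp only [RingHom.comp_apply] at this
      rw [e1, ← this, hva]) e2
  rw [e3] at e4
  obtain ⟨p, hp, hpo⟩ := casselsPfister hw (fun i => w i * v i) _ v₀' e4 (by
    rw [← e5, diagB]
    exact Finset.sum_congr rfl fun i _ => by simp only [map_mul]; ring)
  have hpd := hw.natDegree_le p 1 (by rw [hp]; exact natDegree_quadratic_le)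
  have hlin : ∀ i, ∃ s t, p i = C s * X + C t :=
    fun i => exists_eq_X_add_C_of_natDegree_le_one (hpd i)
  choose p₁ p₀ hpp using hlin
  rw [show p = fun i => C (p₁ i) * X + C (p₀ i) from funext hpp] at hp
  obtain ⟨f1, f2, f3⟩ := diagQ_linear_coeffs _ p₁ p₀ _ _ _ hp
  have hc : ∀ n, ∑ i, w i * v i * (p i).coeff n = 0 := by
    intro n
    simpa only [finsetSum_coeff, coeff_C_mul, coeff_zero] using congrArg (fun q => coeff q n) hpo
  refine ⟨v, p₁, p₀, hva, f1, f3, ?_, ?_, mul_left_cancel₀ h2 f2⟩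
  · rw [← hc 1, diagB]
    exact Finset.sum_congr rfl fun i _ => by rw [hpp]; simp; ring
  · rw [← hc 0, diagB]
    exact Finset.sum_congr rfl fun i _ => by rw [hpp]; simp; ring

end Subform

section SubformTheorem

open MvPolynomial

/-- The affine polynomial `X₀² + a X₁² + α X₂² + 2β X₂ + γ`. -/
def reducedPoly {k : Type*} [Field k] (a α β γ : k) : MvPolynomial (Fin 3) k :=
  X 0 ^ 2 + C a * X 1 ^ 2 + C α * X 2 ^ 2 + C (2 * β) * X 2 + C γ

/-- The subform theorem: a form `⟨1, A, B, ABd⟩` that is isotropic modulo `reducedPoly a α β γ`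
and becomes an anisotropic Pfister form over `L ∋ √d` contains the form of the polynomial. -/
theorem subform_theorem {k L : Type*} [Field k] [Field L] [Algebra k L] (h2 : (2 : L) ≠ 0)
    (a α β γ A B d : k) (s : L) (hs : s ^ 2 = algebraMap k L d) (hd : d ≠ 0)
    (han : DiagAniso ![1, algebraMap k L A, algebraMap k L B, algebraMap k L A * algebraMap k L B])
    (P : Fin 4 → MvPolynomial (Fin 3) k)
    (hdvd : reducedPoly a α β γ ∣
      P 0 ^ 2 + C A * P 1 ^ 2 + C B * P 2 ^ 2 + C (A * B * d) * P 3 ^ 2)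
    (hnd : reducedPoly a α β γ ∣ P 3 → reducedPoly a α β γ ∣ 1) :
    ∃ v p₁ p₀ : Fin 3 → L,
      diagQ ![algebraMap k L A, algebraMap k L B, algebraMap k L A * algebraMap k L B] v
        = algebraMap k L a ∧
      diagQ ![algebraMap k L A, algebraMap k L B, algebraMap k L A * algebraMap k L B] p₁
        = algebraMap k L α ∧
      diagQ ![algebraMap k L A, algebraMap k L B, algebraMap k L A * algebraMap k L B] p₀
        = algebraMap k L γ ∧
      diagB ![algebraMap k L A, algebraMap k L B, algebraMap k L A * algebraMap k L B] v p₁ = 0 ∧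
      diagB ![algebraMap k L A, algebraMap k L B, algebraMap k L A * algebraMap k L B] v p₀ = 0 ∧
      diagB ![algebraMap k L A, algebraMap k L B, algebraMap k L A * algebraMap k L B] p₁ p₀
        = algebraMap k L β := by
  set A' := algebraMap k L A with hA'
  set B' := algebraMap k L B with hB'
  have hs0 : s ≠ 0 := by
    rintro rfl
    apply hd
    simpa using hs.symm
  let j₀ : MvPolynomial (Fin 0) k →+* L :=
    (algebraMap k L).comp (isEmptyAlgEquiv k (Fin 0) : MvPolynomial (Fin 0) k →+* k)
  have hj₀ : Function.Injective j₀ :=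
    (algebraMap k L).injective.comp (isEmptyAlgEquiv k (Fin 0)).injective
  have hj₀C : ∀ x, j₀ (C x) = algebraMap k L x := by
    intro x
    show algebraMap k L (isEmptyAlgEquiv k (Fin 0) (C x)) = _
    rw [← algebraMap_eq, AlgEquiv.commutes]
    rfl
  let j := ratFuncEmb (ratFuncEmb j₀)
  have hj : Function.Injective j := ratFuncEmb_injective _ (ratFuncEmb_injective _ hj₀)
  let ι : L →+* RatFunc (RatFunc L) :=
    ((algebraMap (Polynomial (RatFunc L)) (RatFunc (RatFunc L))).comp Polynomial.C).comp
      ((algebraMap (Polynomial L) (RatFunc L)).comp Polynomial.C)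
  have hjC : ∀ x, j (C x) = ι (algebraMap k L x) := by
    intro x
    simp only [j, ratFuncEmb_C, hj₀C, ι, RingHom.comp_apply]
  let g : MvPolynomial (Fin 2) k := C a * X 0 ^ 2 + C α * X 1 ^ 2 + C (2 * β) * X 1 + C γ
  have hf : finSuccEquiv k 2 (reducedPoly a α β γ) = Polynomial.X ^ 2 + Polynomial.C g := by
    have hX1 : finSuccEquiv k 2 (X 1) = Polynomial.C (X 0) := finSuccEquiv_X_succ (j := 0)
    have hX2 : finSuccEquiv k 2 (X 2) = Polynomial.C (X 1) := finSuccEquiv_X_succ (j := 1)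
    have hC : ∀ x : k, finSuccEquiv k 2 (C x) = Polynomial.C (C x) := by
      intro x; simp [finSuccEquiv_apply]
    simp only [reducedPoly, map_add, map_mul, map_pow, hX1, hX2, hC, finSuccEquiv_X_zero, g]
    ring
  let Ψ : MvPolynomial (Fin 3) k →+* Polynomial (RatFunc (RatFunc L)) :=
    (Polynomial.mapRingHom j).comp (finSuccEquiv k 2 : _ →+* _)
  have hΨC : ∀ x : k, Ψ (C x) = Polynomial.C (ι (algebraMap k L x)) := by
    intro x
    have hC : finSuccEquiv k 2 (C x) = Polynomial.C (C x) := by simp [finSuccEquiv_apply]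
    simp [Ψ, hC, hjC]
  have hΨf : Ψ (reducedPoly a α β γ) = Polynomial.X ^ 2 + Polynomial.C (j g) := by
    simp [Ψ, hf]
  have hΨdvd : ∀ p, Ψ (reducedPoly a α β γ) ∣ Ψ p ↔ reducedPoly a α β γ ∣ p := by
    intro p
    have h1 : reducedPoly a α β γ ∣ p ↔
        finSuccEquiv k 2 (reducedPoly a α β γ) ∣ finSuccEquiv k 2 p :=
      (map_dvd_iff (finSuccEquiv k 2)).symm
    rw [h1, ← Polynomial.map_dvd_map j hj (by rw [hf]; exact monic_X_sq_add_C g)]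
    rfl
  have hn1 : ¬ reducedPoly a α β γ ∣ 1 := by
    rw [← hΨdvd, hΨf, map_one]
    intro h
    have := Polynomial.natDegree_le_of_dvd h one_ne_zero
    rw [natDegree_X_sq_add_C] at this
    simp at this
  have hw4 : DiagAniso ![1, ι A', ι B', ι A' * ι B'] := by
    have h1 : DiagAniso (fun i => ι ((![1, A', B', A' * B'] : Fin 4 → L) i)) :=
      (han.fractionRing (K := RatFunc L)).fractionRing (K := RatFunc (RatFunc L))
    convert h1 using 1
    funext i
    fin_cases i <;> simp
  have hw3 : DiagAniso ![A', B', A' * B'] := by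
    intro x hx
    have h1 := han ![0, x 0, x 1, x 2] (by
      simp only [diagQ, Fin.sum_univ_four, Fin.sum_univ_three, Matrix.cons_val] at hx ⊢
      linear_combination hx)
    funext i
    fin_cases i
    · simpa using congrFun h1 1
    · simpa using congrFun h1 2
    · simpa using congrFun h1 3
  obtain ⟨Q, hQ⟩ := pure_represents_of_dvd (j g) (ι A') (ι B') (ι s) (fun i => Ψ (P i)) hw4
    (by simpa using hs0) (by
      have := ι.injective.ne h2
      rwa [map_ofNat, map_zero] at this) (by
      have h1 := map_dvd Ψ hdvd
      rw [hΨf] at h1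
      convert h1 using 1
      simp only [map_add, map_mul, map_pow, hΨC, ← hA', ← hB', ← hs])
    (by
      rw [← hΨf, hΨdvd]
      exact fun h => hn1 (hnd h))
  refine subform_of_represents hw3 h2 _ _ _ _ Q ?_
  have hw : (fun i => algebraMap (Polynomial (RatFunc L)) (RatFunc (RatFunc L))
      (Polynomial.C (algebraMap (Polynomial L) (RatFunc L)
        (Polynomial.C ((![A', B', A' * B'] : Fin 3 → L) i))))) = ![ι A', ι B', ι A' * ι B'] := by
    funext i
    fin_cases i <;> simp [ι]
  rw [hw, hQ]
  have hX1 : j (X 1) = algebraMap (Polynomial (RatFunc L)) (RatFunc (RatFunc L))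
      (Polynomial.C (algebraMap (Polynomial L) (RatFunc L) Polynomial.X)) := by
    rw [show (X 1 : MvPolynomial (Fin 2) k) = X (Fin.succ 0) from rfl]
    simp only [j, ratFuncEmb_X_succ, ratFuncEmb_X_zero]
  have hX0 : j (X 0) = algebraMap (Polynomial (RatFunc L)) (RatFunc (RatFunc L)) Polynomial.X :=
    ratFuncEmb_X_zero _
  simp only [g, map_add, map_mul, map_pow, hX1, hX0, hjC, ι, RingHom.comp_apply, map_ofNat]
  ring

end SubformTheorem

section QuadraticExtension

/-- `L = k ⊕ k s` is the quadratic extension of `k` generated by a square root `s` of `d`. -/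
structure IsQuadExt (k : Type*) {L : Type*} [Field k] [Field L] [Algebra k L] (d : k) (s : L) :
    Prop where
  sq : s ^ 2 = algebraMap k L d
  rep : ∀ x : L, ∃ a b : k, x = algebraMap k L a + s * algebraMap k L b
  indep : ∀ a b : k, algebraMap k L a + s * algebraMap k L b = 0 → a = 0 ∧ b = 0

theorem exists_isQuadExt.{w} {k : Type w} [Field k] (d : k) (hd : ¬ IsSquare d) :
    ∃ (L : Type w) (_ : Field L) (_ : Algebra k L) (s : L), IsQuadExt k d s := by
  have : Fact (∀ r : k, r ^ 2 ≠ d + 0 * r) := ⟨fun r hr => hd ⟨r, by rw [← sq, hr]; ring⟩⟩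
  refine ⟨QuadraticAlgebra k d 0, inferInstance, inferInstance, QuadraticAlgebra.omega, ?_, ?_, ?_⟩
  · ext <;> simp [sq]
  · intro x
    refine ⟨x.re, x.im, ?_⟩
    ext <;> simp
  · intro a b h
    constructor
    · simpa using congrArg QuadraticAlgebra.re h
    · simpa using congrArg QuadraticAlgebra.im h

variable {k L : Type*} [Field k] [Field L] [Algebra k L] {d : k} {s : L}

theorem IsQuadExt.eq_iff (hs : IsQuadExt k d s) (a b a' b' : k) :
    algebraMap k L a + s * algebraMap k L b = algebraMap k L a' + s * algebraMap k L b' ↔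
      a = a' ∧ b = b' := by
  constructor
  · intro h
    have := hs.indep (a - a') (b - b') (by simp only [map_sub]; linear_combination h)
    exact ⟨sub_eq_zero.mp this.1, sub_eq_zero.mp this.2⟩
  · rintro ⟨rfl, rfl⟩
    rfl

/-- A scalar represented by `⟨1, A⟩` over `k(√d)` is, up to a value of `⟨1, Ad⟩`, represented by
`⟨1, A⟩` over `k`. -/
theorem IsQuadExt.exists_similarity_factor (hs : IsQuadExt k d s) (h2 : (2 : k) ≠ 0) {A b : k}
    (hA : A ≠ 0) (w₀ w₁ : L)
    (h : algebraMap k L b = w₀ ^ 2 + algebraMap k L A * w₁ ^ 2) :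
    ∃ X Y Z W : k, (Z ≠ 0 ∨ W ≠ 0) ∧ b * (Z ^ 2 + A * d * W ^ 2) = X ^ 2 + A * Y ^ 2 := by
  obtain ⟨a₀, a₁, rfl⟩ := hs.rep w₀
  obtain ⟨b₀, b₁, rfl⟩ := hs.rep w₁
  obtain ⟨e1, e2⟩ := (hs.eq_iff b 0 (a₀ ^ 2 + d * a₁ ^ 2 + A * (b₀ ^ 2 + d * b₁ ^ 2))
    (2 * (a₀ * a₁ + A * (b₀ * b₁)))).mp (by
      simp only [map_add, map_mul, map_pow, map_ofNat, map_zero]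
      linear_combination h + ((algebraMap k L a₁) ^ 2 + algebraMap k L A * (algebraMap k L b₁) ^ 2)
        * hs.sq)
  have e2 := (mul_eq_zero.mp e2.symm).resolve_left h2
  by_cases ha : a₁ = 0
  · subst ha
    have hb : b₀ = 0 ∨ b₁ = 0 := by simpa [hA] using e2
    by_cases hb1 : b₁ = 0
    · exact ⟨a₀, b₀, 1, 0, Or.inl one_ne_zero, by rw [e1, hb1]; ring⟩
    · have hb0 := hb.resolve_right hb1
      exact ⟨b, 0, a₀, b₁, Or.inr hb1, by rw [e1, hb0]; ring⟩
  · have ht : a₀ = -A * b₀ * (b₁ / a₁) := by field_simp; linear_combination e2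
    have hb1 : b₁ = b₁ / a₁ * a₁ := by field_simp
    set t := b₁ / a₁
    refine ⟨A * t * (A * b₀ ^ 2 + d * a₁ ^ 2), A * b₀ ^ 2 + d * a₁ ^ 2, A * b₀, a₁, Or.inr ha, ?_⟩
    rw [e1, ht, hb1]
    ring

theorem diagAniso_four_iff {R : Type*} [CommRing R] (a b c e : R) :
    DiagAniso ![a, b, c, e] ↔ ∀ x₀ x₁ x₂ x₃ : R,
      a * x₀ ^ 2 + b * x₁ ^ 2 + c * x₂ ^ 2 + e * x₃ ^ 2 = 0 →
        x₀ = 0 ∧ x₁ = 0 ∧ x₂ = 0 ∧ x₃ = 0 := by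
  constructor
  · intro h x₀ x₁ x₂ x₃ hx
    have h1 := h ![x₀, x₁, x₂, x₃] (by
      simpa only [diagQ, Fin.sum_univ_four, Matrix.cons_val] using hx)
    exact ⟨congrFun h1 0, congrFun h1 1, congrFun h1 2, congrFun h1 3⟩
  · intro h x hx
    obtain ⟨h0, h1, h2, h3⟩ := h (x 0) (x 1) (x 2) (x 3) (by
      simpa only [diagQ, Fin.sum_univ_four, Matrix.cons_val] using hx)
    funext i
    fin_cases i <;> assumption

/-- An anisotropic form of dimension four and discriminant `d` becomes, over `k(√d)`, an
anisotropic Pfister form. -/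
theorem IsQuadExt.diagAniso (hs : IsQuadExt k d s) (h2 : (2 : k) ≠ 0) {A B : k}
    (han : DiagAniso ![1, A, B, A * B * d]) :
    DiagAniso ![1, algebraMap k L A, algebraMap k L B, algebraMap k L A * algebraMap k L B] := by
  rw [diagAniso_four_iff] at han ⊢
  have hA : A ≠ 0 := by
    rintro rfl
    simpa using (han 0 1 0 0 (by ring)).2.1
  have hB : B ≠ 0 := by
    rintro rfl
    simpa using (han 0 0 1 0 (by ring)).2.2.1
  have hA' : algebraMap k L A ≠ 0 := by simpa using hA
  have hnsq : ∀ e : L, e ^ 2 + algebraMap k L A ≠ 0 := by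
    intro e he
    obtain ⟨e₀, e₁, rfl⟩ := hs.rep e
    obtain ⟨f1, f2⟩ := hs.indep (e₀ ^ 2 + d * e₁ ^ 2 + A) (2 * (e₀ * e₁)) (by
      simp only [map_add, map_mul, map_pow, map_ofNat]
      linear_combination he - (algebraMap k L e₁) ^ 2 * hs.sq)
    have f2 : e₀ = 0 ∨ e₁ = 0 := by simpa [h2] using f2
    rcases f2 with rfl | rfl
    · simpa using (han 0 0 (d * e₁) 1 (by linear_combination B * d * f1)).2.2.2
    · simpa using (han e₀ 1 0 0 (by linear_combination f1)).2.1
  have h2sq : ∀ e f : L, e ^ 2 + algebraMap k L A * f ^ 2 = 0 → e = 0 ∧ f = 0 := by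
    intro e f h
    have hf : f = 0 := by
      by_contra hf
      apply hnsq (e / f)
      field_simp
      linear_combination h
    subst hf
    simpa using h
  intro x₀ x₁ x₂ x₃ hx
  by_cases hm : x₂ ^ 2 + algebraMap k L A * x₃ ^ 2 = 0
  · obtain ⟨h2', h3'⟩ := h2sq _ _ hm
    obtain ⟨h0', h1'⟩ := h2sq x₀ x₁ (by linear_combination hx - algebraMap k L B * hm)
    exact ⟨h0', h1', h2', h3'⟩
  · exfalso
    obtain ⟨X, Y, Z, W, hZW, h⟩ := hs.exists_similarity_factor h2 (b := -B) hA
      ((x₀ * x₂ + algebraMap k L A * (x₁ * x₃)) / (x₂ ^ 2 + algebraMap k L A * x₃ ^ 2))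
      ((x₁ * x₂ - x₀ * x₃) / (x₂ ^ 2 + algebraMap k L A * x₃ ^ 2)) (by
        rw [map_neg]
        field_simp
        linear_combination (-(x₂ ^ 2 + algebraMap k L A * x₃ ^ 2)) * hx)
    have := han X Y Z W (by linear_combination -h)
    simp [this.2.2.1, this.2.2.2] at hZW

end QuadraticExtension

section Descent

/-- The determinant of three vectors. -/
def tripleDet {R : Type*} [CommRing R] (x y z : Fin 3 → R) : R :=
  x 0 * (y 1 * z 2 - y 2 * z 1) - x 1 * (y 0 * z 2 - y 2 * z 0) + x 2 * (y 0 * z 1 - y 1 * z 0)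

theorem gram_det_of_orthogonal {R : Type*} [CommRing R] (w x y z : Fin 3 → R)
    (hxy : diagB w x y = 0) (hxz : diagB w x z = 0) (hyz : diagB w y z = 0) :
    w 0 * w 1 * w 2 * tripleDet x y z ^ 2 = diagQ w x * diagQ w y * diagQ w z := by
  have key : w 0 * w 1 * w 2 * tripleDet x y z ^ 2 = diagQ w x * diagQ w y * diagQ w z +
      2 * (diagB w x y * diagB w y z * diagB w x z) - diagB w x y ^ 2 * diagQ w z -
      diagB w x z ^ 2 * diagQ w y - diagB w y z ^ 2 * diagQ w x := by
    simp only [diagQ, diagB, tripleDet, Fin.sum_univ_three]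
    ring
  rw [key, hxy, hxz, hyz]
  ring

/-- Parseval's identity in dimension three. -/
theorem parseval_three {R : Type*} [CommRing R] (w t y z : Fin 3 → R) (hyz : diagB w y z = 0) :
    diagQ w t * (diagQ w y * diagQ w z) = diagB w t y ^ 2 * diagQ w z +
      diagB w t z ^ 2 * diagQ w y + w 0 * w 1 * w 2 * tripleDet t y z ^ 2 := by
  have key : w 0 * w 1 * w 2 * tripleDet t y z ^ 2 = diagQ w t * diagQ w y * diagQ w z +
      2 * (diagB w t y * diagB w y z * diagB w t z) - diagB w t y ^ 2 * diagQ w z -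
      diagB w t z ^ 2 * diagQ w y - diagB w y z ^ 2 * diagQ w t := by
    simp only [diagQ, diagB, tripleDet, Fin.sum_univ_three]
    ring
  rw [key, hyz]
  ring

theorem exists_orthogonal {k : Type*} [Field k] {w : Fin 3 → k} (hw0 : w 0 ≠ 0)
    (x : Fin 3 → k) : ∃ z : Fin 3 → k, z ≠ 0 ∧ diagB w x z = 0 := by
  by_cases hx : x 0 = 0
  · refine ⟨![1, 0, 0], fun h => one_ne_zero (congrFun h 0), ?_⟩
    simp [diagB, Fin.sum_univ_three, hx]
  · refine ⟨![-(w 1 * x 1), w 0 * x 0, 0], fun h => mul_ne_zero hw0 hx (congrFun h 1), ?_⟩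
    simp only [diagB, Fin.sum_univ_three, Matrix.cons_val]
    ring

/-- Similarity of diagonal forms, by a linear map given as a matrix. -/
def DiagSimilar {k : Type*} [Field k] (w w' : Fin 4 → k) : Prop :=
  ∃ c : k, c ≠ 0 ∧ ∃ M : Matrix (Fin 4) (Fin 4) k, ∀ x, diagQ w' (M.mulVec x) = c * diagQ w x

theorem DiagSimilar.trans {k : Type*} [Field k] {w w' w'' : Fin 4 → k} (h : DiagSimilar w w')
    (h' : DiagSimilar w' w'') : DiagSimilar w w'' := by
  obtain ⟨c, hc, M, hM⟩ := h
  obtain ⟨c', hc', M', hM'⟩ := h'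
  refine ⟨c' * c, mul_ne_zero hc' hc, M' * M, fun x => ?_⟩
  rw [← Matrix.mulVec_mulVec, hM', hM, mul_assoc]

variable {k : Type*} [Field k]

theorem diagSimilar_to_frame (A B d : k) (x z : Fin 3 → k)
    (hx : diagQ ![A, B, A * B * d] x ≠ 0) (hz : diagQ ![A, B, A * B * d] z ≠ 0)
    (hxz : diagB ![A, B, A * B * d] x z = 0) :
    DiagSimilar ![1, A, B, A * B * d]
      ![1, diagQ ![A, B, A * B * d] x, diagQ ![A, B, A * B * d] z,
        diagQ ![A, B, A * B * d] z * (diagQ ![A, B, A * B * d] x * d)] := by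
  set r := diagQ ![A, B, A * B * d] x
  set u := diagQ ![A, B, A * B * d] z
  refine ⟨1, one_ne_zero, !![1, 0, 0, 0;
    0, A * x 0 / r, B * x 1 / r, A * B * d * x 2 / r;
    0, A * z 0 / u, B * z 1 / u, A * B * d * z 2 / u;
    0, A * B * (x 1 * z 2 - x 2 * z 1) / (r * u), A * B * (x 2 * z 0 - x 0 * z 2) / (r * u),
      A * B * (x 0 * z 1 - x 1 * z 0) / (r * u)], fun t => ?_⟩
  have h := parseval_three ![A, B, A * B * d] ![t 1, t 2, t 3] x z hxz
  change _ * (r * u) = _ * u + _ * r + _ at h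
  simp only [diagQ, diagB, tripleDet, Fin.sum_univ_three, Fin.sum_univ_four, Matrix.cons_val,
    Matrix.mulVec, dotProduct, Matrix.of_apply] at h ⊢
  field_simp
  linear_combination -h

theorem diagSimilar_of_frame (A B d : k) (y z : Fin 3 → k)
    (hyz : diagB ![A, B, A * B * d] y z = 0) :
    DiagSimilar
      ![1, diagQ ![A, B, A * B * d] y, diagQ ![A, B, A * B * d] z,
        diagQ ![A, B, A * B * d] z * (diagQ ![A, B, A * B * d] y * d)]
      ![1, A, B, A * B * d] := by
  refine ⟨1, one_ne_zero, !![1, 0, 0, 0;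
    0, y 0, z 0, B * d * (y 1 * z 2 - y 2 * z 1);
    0, y 1, z 1, A * d * (y 2 * z 0 - y 0 * z 2);
    0, y 2, z 2, y 0 * z 1 - y 1 * z 0], fun t => ?_⟩
  simp only [diagQ, diagB, Fin.sum_univ_three, Fin.sum_univ_four, Matrix.cons_val,
    Matrix.mulVec, dotProduct, Matrix.of_apply] at hyz ⊢
  linear_combination (2 * t 1 * t 2 + d * t 3 ^ 2 * (-(A * (y 0 * z 0) + B * (y 1 * z 1) +
    A * B * d * (y 2 * z 2)))) * hyz

theorem diagSimilar_of_factor (r u v d X Y Z W : k) (hμ : X ^ 2 + r * Y ^ 2 ≠ 0)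
    (h : u * v * (Z ^ 2 + r * d * W ^ 2) = X ^ 2 + r * Y ^ 2) :
    DiagSimilar ![1, r, u, u * (r * d)] ![1, r, v, v * (r * d)] := by
  refine ⟨_, hμ, !![X, -r * Y, 0, 0; Y, X, 0, 0;
    0, 0, u * Z, -(u * (r * d * W)); 0, 0, u * W, u * Z], fun t => ?_⟩
  simp only [diagQ, Fin.sum_univ_four, Matrix.cons_val,
    Matrix.mulVec, dotProduct, Matrix.of_apply]
  linear_combination (u * t 2 ^ 2 + u * r * d * t 3 ^ 2) * h

theorem gram_product {R : Type*} [CommRing R] (w t₀ t₁ t₂ y₀ y₁ y₂ : Fin 3 → R) :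
    tripleDet ![diagB w t₀ y₀, diagB w t₀ y₁, diagB w t₀ y₂]
      ![diagB w t₁ y₀, diagB w t₁ y₁, diagB w t₁ y₂]
      ![diagB w t₂ y₀, diagB w t₂ y₁, diagB w t₂ y₂] =
      w 0 * w 1 * w 2 * tripleDet t₀ t₁ t₂ * tripleDet y₀ y₁ y₂ := by
  simp only [tripleDet, diagB, Fin.sum_univ_three, Matrix.cons_val]
  ring

/-- Two ternary forms over `k` of the same discriminant which become isometric over `k(√d)`
have a common value over `k`. -/
theorem IsQuadExt.exists_rational_vector {L : Type*} [Field L] [Algebra k L] {d : k} {s : L}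
    (hs : IsQuadExt k d s) (h2 : (2 : k) ≠ 0) (w g : Fin 3 → k) (e : k) (he : e ≠ 0)
    (hw : w 0 * w 1 * w 2 ≠ 0) (hdet : g 0 * g 1 * g 2 = e ^ 2 * (w 0 * w 1 * w 2))
    (t : Fin 3 → Fin 3 → L)
    (hgram : ∀ i j, diagB (fun l => algebraMap k L (w l)) (t i) (t j) =
      if i = j then algebraMap k L (g i) else 0) :
    ∃ x : Fin 3 → k, x ≠ 0 ∧ ∃ y : Fin 3 → k,
      ∀ l, ∑ j, algebraMap k L (x j) * t j l = algebraMap k L (y l) := by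
  choose X Y hXY using fun i l => hs.rep (t i l)
  set m : Fin 3 → Fin 3 → k := fun i j => diagB w (X i) (Y j) with hm
  set S : Fin 3 → Fin 3 → k := fun i j => diagB w (Y i) (Y j) with hS
  have hS_comm : ∀ i j, S i j = S j i := fun i j => diagB_comm _ _ _
  have hskew : ∀ i j, m i j + m j i = 0 := by
    intro i j
    have h1 := hgram i j
    have h3 : (if i = j then algebraMap k L (g i) else 0) =
        algebraMap k L (if i = j then g i else 0) + s * algebraMap k L 0 := by
      split_ifs <;> simp
    rw [h3] at h1
    refine ((hs.eq_iff (diagB w (X i) (X j) + d * S i j) (m i j + m j i)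
      (if i = j then g i else 0) 0).mp ?_).2
    rw [← h1]
    simp only [hm, hS, diagB, Fin.sum_univ_three, hXY, map_add, map_mul, ← hs.sq]
    ring
  have hdiag : ∀ i, m i i = 0 := by
    intro i
    have := hskew i i
    rw [← two_mul] at this
    exact (mul_eq_zero.mp this).resolve_left h2
  have hmix : ∀ i j, diagB (fun l => algebraMap k L (w l)) (t i) (fun l => algebraMap k L (Y j l))
      = algebraMap k L (m i j) + s * algebraMap k L (S i j) := by
    intro i j
    simp only [hm, hS, diagB, Fin.sum_univ_three, hXY, map_add, map_mul]
    ring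
  have hT : tripleDet (t 0) (t 1) (t 2) = algebraMap k L e ∨
      tripleDet (t 0) (t 1) (t 2) = algebraMap k L (-e) := by
    rw [map_neg]
    apply sq_eq_sq_iff_eq_or_eq_neg.mp
    have h1 := gram_det_of_orthogonal (fun l => algebraMap k L (w l)) (t 0) (t 1) (t 2)
      (by simp [hgram]) (by simp [hgram]) (by simp [hgram])
    simp only [← diagB_self, hgram, if_true] at h1
    have h3 := congrArg (algebraMap k L) hdet
    have h4 : algebraMap k L (w 0 * w 1 * w 2) ≠ 0 := by simpa using hw
    apply mul_left_cancel₀ h4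
    simp only [map_mul, map_pow] at h3 ⊢
    rw [h1, h3]
    ring
  obtain ⟨e', he', hT⟩ : ∃ e' : k, e' ≠ 0 ∧ tripleDet (t 0) (t 1) (t 2) = algebraMap k L e' := by
    rcases hT with h | h
    · exact ⟨e, he, h⟩
    · exact ⟨-e, neg_ne_zero.mpr he, h⟩
  have hY : tripleDet (Y 0) (Y 1) (Y 2) = 0 := by
    have h1 := gram_product (fun l => algebraMap k L (w l)) (t 0) (t 1) (t 2)
      (fun l => algebraMap k L (Y 0 l)) (fun l => algebraMap k L (Y 1 l))
      (fun l => algebraMap k L (Y 2 l))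
    simp only [hmix] at h1
    rw [hT, hdiag, hdiag, hdiag, hS_comm 1 0, hS_comm 2 0, hS_comm 2 1,
      eq_neg_of_add_eq_zero_right (hskew 0 1), eq_neg_of_add_eq_zero_right (hskew 0 2),
      eq_neg_of_add_eq_zero_right (hskew 1 2)] at h1
    have h3 := (hs.eq_iff (w 0 * w 1 * w 2 * e' * tripleDet (Y 0) (Y 1) (Y 2)) 0 0
      (m 1 2 ^ 2 * S 0 0 + m 0 2 ^ 2 * S 1 1 + m 0 1 ^ 2 * S 2 2 - 2 * m 0 2 * m 1 2 * S 0 1 +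
        2 * m 0 1 * m 1 2 * S 0 2 - 2 * m 0 1 * m 0 2 * S 1 2 +
        d * (S 0 0 * (S 1 1 * S 2 2 - S 1 2 ^ 2) - S 0 1 * (S 0 1 * S 2 2 - S 1 2 * S 0 2) +
          S 0 2 * (S 0 1 * S 1 2 - S 1 1 * S 0 2)))).mp (by
      simp only [tripleDet, Matrix.cons_val, map_add, map_sub, map_mul, map_pow, map_neg,
        map_zero, map_ofNat, ← hs.sq] at h1 ⊢
      linear_combination -h1)
    simpa [hw, he'] using h3.1
  obtain ⟨x, hx, hxY⟩ := (Matrix.exists_vecMul_eq_zero_iff (M := Matrix.of Y)).mpr (by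
    rw [← hY, Matrix.det_fin_three, tripleDet]
    simp only [Matrix.of_apply]
    ring)
  refine ⟨x, hx, fun l => ∑ j, x j * X j l, fun l => ?_⟩
  have h1 : ∑ j, x j * Y j l = 0 := congrFun hxY l
  have h3 := congrArg (algebraMap k L) h1
  simp only [Fin.sum_univ_three, map_add, map_mul, map_zero, hXY] at h3 ⊢
  linear_combination s * h3

/-- Anisotropic quaternary forms with the same discriminant `d` that become isometric over
`k(√d)` are similar over `k`. -/
theorem IsQuadExt.diagSimilar_descent {L : Type*} [Field L] [Algebra k L] {d : k} {s : L}
    (hs : IsQuadExt k d s) (h2 : (2 : k) ≠ 0) (hd : d ≠ 0) {A B A' B' : k}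
    (han : DiagAniso ![1, A, B, A * B * d]) (han' : DiagAniso ![1, A', B', A' * B' * d])
    (t : Fin 3 → Fin 3 → L)
    (hgram : ∀ i j, diagB (fun l => algebraMap k L ((![A', B', A' * B' * d] : Fin 3 → k) l))
      (t i) (t j) = if i = j then algebraMap k L ((![A, B, A * B * d] : Fin 3 → k) i) else 0) :
    DiagSimilar ![1, A, B, A * B * d] ![1, A', B', A' * B' * d] := by
  have pos : ∀ {A B : k}, DiagAniso ![1, A, B, A * B * d] → A ≠ 0 ∧ B ≠ 0 ∧
      ∀ x, diagQ ![A, B, A * B * d] x = 0 → x = 0 := by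
    intro A B h
    rw [diagAniso_four_iff] at h
    refine ⟨?_, ?_, fun x hx => ?_⟩
    · rintro rfl
      simpa using (h 0 1 0 0 (by ring)).2.1
    · rintro rfl
      simpa using (h 0 0 1 0 (by ring)).2.2.1
    · simp only [diagQ, Fin.sum_univ_three, Matrix.cons_val] at hx
      obtain ⟨-, h1, h2, h3⟩ := h 0 (x 0) (x 1) (x 2) (by linear_combination hx)
      funext i
      fin_cases i <;> assumption
  obtain ⟨hA, hB, hφ⟩ := pos han
  obtain ⟨hA', hB', hφ'⟩ := pos han'
  set w' : Fin 3 → k := ![A', B', A' * B' * d] with hw'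
  set w : Fin 3 → k := ![A, B, A * B * d] with hw
  obtain ⟨x, hx, y, hxy⟩ := hs.exists_rational_vector h2 w' w (A * B / (A' * B'))
    (div_ne_zero (mul_ne_zero hA hB) (mul_ne_zero hA' hB')) (by
      simp only [hw', Matrix.cons_val]
      simp [hA', hB', hd]) (by
      simp only [hw, hw', Matrix.cons_val]
      field_simp) t hgram
  have hbil : ∀ a b : Fin 3 → k, diagB (fun l => algebraMap k L (w' l))
      (fun l => ∑ j, algebraMap k L (a j) * t j l) (fun l => ∑ j, algebraMap k L (b j) * t j l) =
      algebraMap k L (diagB w a b) := by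
    intro a b
    have h1 : diagB (fun l => algebraMap k L (w' l))
      (fun l => ∑ j, algebraMap k L (a j) * t j l) (fun l => ∑ j, algebraMap k L (b j) * t j l) =
      ∑ i, ∑ j, algebraMap k L (a i) * algebraMap k L (b j) *
        diagB (fun l => algebraMap k L (w' l)) (t i) (t j) := by
      simp only [diagB, Fin.sum_univ_three]
      ring
    rw [h1]
    simp only [hgram]
    simp [diagB]
    exact Finset.sum_congr rfl fun i _ => by ring
  have hr : diagQ w' y = diagQ w x := by
    apply (algebraMap k L).injective
    rw [← diagB_self w x, ← hbil, map_diagQ, ← diagB_self]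
    simp only [hxy]
  have hr0 : diagQ w x ≠ 0 := fun h => hx (hφ x h)
  obtain ⟨z, hz, hxz⟩ := exists_orthogonal (w := w) hA x
  obtain ⟨z', hz', hyz⟩ := exists_orthogonal (w := w') hA' y
  have hu0 : diagQ w z ≠ 0 := fun h => hz (hφ z h)
  have hv0 : diagQ w' z' ≠ 0 := fun h => hz' (hφ' z' h)
  have hfac : algebraMap k L (diagQ w z * diagQ w' z') =
      (diagB (fun l => algebraMap k L (w' l)) (fun l => ∑ j, algebraMap k L (z j) * t j l)
        (fun l => algebraMap k L (z' l))) ^ 2 + algebraMap k L (diagQ w x) *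
      (s * algebraMap k L (A' * B') * tripleDet (fun l => ∑ j, algebraMap k L (z j) * t j l)
        (fun l => algebraMap k L (y l)) (fun l => algebraMap k L (z' l)) /
          algebraMap k L (diagQ w x)) ^ 2 := by
    have h1 := parseval_three (fun l => algebraMap k L (w' l))
      (fun l => ∑ j, algebraMap k L (z j) * t j l)
        (fun l => algebraMap k L (y l)) (fun l => algebraMap k L (z' l))
        (by rw [← map_diagB, hyz, map_zero])
    have h3 : diagB (fun l => algebraMap k L (w' l))
        (fun l => ∑ j, algebraMap k L (z j) * t j l) (fun l => algebraMap k L (y l)) = 0 := by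
      simp only [← hxy]
      rw [hbil, diagB_comm, hxz, map_zero]
    rw [h3, ← map_diagQ, ← map_diagQ, ← diagB_self (fun l => algebraMap k L (w' l)), hbil,
      diagB_self, hr] at h1
    have h4 : algebraMap k L (diagQ w x) ≠ 0 := by simpa using hr0
    have h5 : algebraMap k L (w' 0) * algebraMap k L (w' 1) * algebraMap k L (w' 2) =
        algebraMap k L (A' * B') ^ 2 * s ^ 2 := by
      rw [hs.sq]
      simp only [hw', Matrix.cons_val, map_mul]
      ring
    rw [h5] at h1
    rw [map_mul]
    field_simp
    linear_combination h1
  obtain ⟨X, Y, Z, W, hZW, h⟩ := hs.exists_similarity_factor h2 hr0 _ _ hfac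
  have hμ : X ^ 2 + diagQ w x * Y ^ 2 ≠ 0 := by
    intro hμ
    have h1 : Z ^ 2 + diagQ w x * d * W ^ 2 = 0 := by
      have := h.trans hμ
      simpa [hu0, hv0] using this
    have h3 := hφ' ![Z * z' 0 + W * (B' * d * (y 1 * z' 2 - y 2 * z' 1)),
      Z * z' 1 + W * (A' * d * (y 2 * z' 0 - y 0 * z' 2)),
      Z * z' 2 + W * (y 0 * z' 1 - y 1 * z' 0)] (by
        rw [← hr] at h1
        simp only [hw', diagQ, diagB, Fin.sum_univ_three, Matrix.cons_val] at h1 hyz ⊢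
        linear_combination (A' * z' 0 ^ 2 + B' * z' 1 ^ 2 + A' * B' * d * z' 2 ^ 2) * h1 -
          d * W ^ 2 * (A' * (y 0 * z' 0) + B' * (y 1 * z' 1) + A' * B' * d * (y 2 * z' 2)) * hyz)
    have h4 : Z * diagQ w' z' = diagB w' z' 0 := by
      rw [← h3]
      simp only [hw', diagQ, diagB, Fin.sum_univ_three, Matrix.cons_val]
      ring
    have hZ : Z = 0 := by simpa [hv0, diagB] using h4
    have hW : W = 0 := by simpa [hZ, hr0, hd] using h1
    simp [hZ, hW] at hZW
  have f1 := diagSimilar_to_frame A B d x z hr0 hu0 hxz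
  have f2 := diagSimilar_of_factor (diagQ w x) (diagQ w z) (diagQ w' z') d X Y Z W hμ h
  have f3 := diagSimilar_of_frame A' B' d y z' hyz
  rw [← hw', hr] at f3
  exact (f1.trans f2).trans f3

end Descent

section DiagonalCase

open MvPolynomial

/-- The form `⟨1, A, B, ABd⟩` has a zero with nonzero last coordinate modulo
`reducedPoly a α β γ`. -/
def HasZeroModulo {k : Type*} [Field k] (a α β γ A B d : k) : Prop :=
  ∃ P : Fin 4 → MvPolynomial (Fin 3) k,
    reducedPoly a α β γ ∣ P 0 ^ 2 + C A * P 1 ^ 2 + C B * P 2 ^ 2 + C (A * B * d) * P 3 ^ 2 ∧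
    (reducedPoly a α β γ ∣ P 3 → reducedPoly a α β γ ∣ 1)

theorem DiagAniso.ne_zero {k ι : Type*} [Field k] [Fintype ι] [DecidableEq ι] {w : ι → k}
    (h : DiagAniso w) (i : ι) : w i ≠ 0 := by
  intro hi
  have := congrFun (h (Pi.single i 1) (by
    rw [diagQ]
    refine Finset.sum_eq_zero fun j _ => ?_
    by_cases hj : j = i
    · subst hj
      simp [hi]
    · simp [hj])) i
  simp at this

theorem diagAniso_of_sq {k : Type*} [Field k] {A B s : k}
    (han : DiagAniso ![1, A, B, A * B * s ^ 2]) : DiagAniso ![1, A, B, A * B] := by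
  have hs : s ≠ 0 := by
    rintro rfl
    simpa using han.ne_zero 3
  rw [diagAniso_four_iff] at han ⊢
  intro x₀ x₁ x₂ x₃ hx
  have := han x₀ x₁ x₂ (x₃ / s) (by field_simp; linear_combination hx)
  simpa [hs] using this

variable {k : Type*} [Field k]

/-- Comparison of discriminants of an orthogonal frame and the ambient form. -/
theorem isSquare_of_frame {L : Type*} [Field L] {a b A B d : L} (ha : a * b ≠ 0)
    (v p₁ p₀ : Fin 3 → L)
    (e1 : diagQ ![A, B, A * B] v = a) (e2 : diagQ ![A, B, A * B] p₁ = b)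
    (e3 : diagQ ![A, B, A * B] p₀ = a * b * d) (e4 : diagB ![A, B, A * B] v p₁ = 0)
    (e5 : diagB ![A, B, A * B] v p₀ = 0) (e6 : diagB ![A, B, A * B] p₁ p₀ = 0) :
    ∃ z : L, z ^ 2 = d := by
  have h := gram_det_of_orthogonal _ _ _ _ e4 e5 e6
  rw [e1, e2, e3] at h
  simp only [Matrix.cons_val] at h
  refine ⟨A * B * tripleDet v p₁ p₀ / (a * b), ?_⟩
  rw [div_pow, div_eq_iff (pow_ne_zero 2 ha)]
  linear_combination h

theorem diagSimilar_of_hasZeroModulo (h2 : (2 : k) ≠ 0) {A B d A' B' d' : k}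
    (han : DiagAniso ![1, A, B, A * B * d]) (han' : DiagAniso ![1, A', B', A' * B' * d'])
    (hdom : HasZeroModulo A B 0 (A * B * d) A' B' d')
    (hdom' : HasZeroModulo A' B' 0 (A' * B' * d') A B d) :
    DiagSimilar ![1, A, B, A * B * d] ![1, A', B', A' * B' * d'] := by
  have hABd : A * B * d ≠ 0 := han.ne_zero 3
  have hABd' : A' * B' * d' ≠ 0 := han'.ne_zero 3
  have hAB : A * B ≠ 0 := left_ne_zero_of_mul hABd
  have hAB' : A' * B' ≠ 0 := left_ne_zero_of_mul hABd'
  have hd : d ≠ 0 := right_ne_zero_of_mul hABd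
  have hd' : d' ≠ 0 := right_ne_zero_of_mul hABd'
  obtain ⟨P, hP, hP3⟩ := hdom
  obtain ⟨P', hP', hP3'⟩ := hdom'
  by_cases hsq : IsSquare d'
  · obtain ⟨s, hs⟩ := hsq
    rw [← sq] at hs
    have hs0 : s ≠ 0 := by
      rintro rfl
      simp [hs] at hd'
    obtain ⟨v, p₁, p₀, e1, e2, e3, e4, e5, e6⟩ := subform_theorem (L := k) h2 A B 0 (A * B * d)
      A' B' d' s hs.symm hd' (diagAniso_of_sq (s := s) (hs ▸ han')) P hP hP3
    refine ⟨1, one_ne_zero, !![1, 0, 0, 0; 0, v 0, p₁ 0, p₀ 0; 0, v 1, p₁ 1, p₀ 1;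
      0, v 2 / s, p₁ 2 / s, p₀ 2 / s], fun t => ?_⟩
    simp only [Algebra.algebraMap_self, RingHom.id_apply, diagQ, diagB, Fin.sum_univ_three,
      Fin.sum_univ_four, Matrix.cons_val, Matrix.mulVec, dotProduct, Matrix.of_apply]
      at e1 e2 e3 e4 e5 e6 ⊢
    rw [hs]
    field_simp
    linear_combination t 1 ^ 2 * e1 + t 2 ^ 2 * e2 + t 3 ^ 2 * e3 + 2 * t 1 * t 2 * e4 +
      2 * t 1 * t 3 * e5 + 2 * t 2 * t 3 * e6
  · obtain ⟨L, _, _, s, hs⟩ := exists_isQuadExt d' hsq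
    have h2L : (2 : L) ≠ 0 := by
      have := (algebraMap k L).injective.ne h2
      rwa [map_ofNat, map_zero] at this
    obtain ⟨v, p₁, p₀, e1, e2, e3, e4, e5, e6⟩ := subform_theorem h2L A B 0 (A * B * d)
      A' B' d' s hs.sq hd' (hs.diagAniso h2 han') P hP hP3
    rw [map_zero] at e6
    obtain ⟨z, hz⟩ := isSquare_of_frame (d := algebraMap k L d)
      (by rw [← map_mul]; simpa using hAB) v p₁ p₀ e1 e2 (by simpa using e3) e4 e5 e6
    obtain ⟨x, y, rfl⟩ := hs.rep z
    obtain ⟨f1, f2⟩ := (hs.eq_iff (x ^ 2 + d' * y ^ 2) (2 * (x * y)) d 0).mp (by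
      simp only [map_add, map_mul, map_pow, map_ofNat, map_zero, ← hz, ← hs.sq]
      ring)
    have f2 : x = 0 ∨ y = 0 := by simpa [h2] using f2
    rcases f2 with rfl | rfl
    · have hy : y ≠ 0 := by
        rintro rfl
        simp at f1
        exact hd f1.symm
      have hdy : d = d' * y ^ 2 := by rw [← f1]; ring
      have hs0 : s ≠ 0 := by
        intro h
        have := hs.sq
        rw [h] at this
        exact hd' (by simpa using this.symm)
      have hyL : algebraMap k L y ≠ 0 := by simpa using hy
      have han₁ : DiagAniso ![1, A, B, A * B * d'] := by
        rw [diagAniso_four_iff] at han ⊢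
        intro x₀ x₁ x₂ x₃ hx
        have := han x₀ x₁ x₂ (x₃ / y) (by rw [hdy]; field_simp; linear_combination hx)
        simpa [hy] using this
      have f1 : DiagSimilar ![1, A, B, A * B * d] ![1, A, B, A * B * d'] := by
        refine ⟨1, one_ne_zero, Matrix.diagonal ![1, 1, 1, y], fun t => ?_⟩
        simp only [diagQ, Fin.sum_univ_four, Matrix.mulVec_diagonal, Matrix.cons_val, hdy]
        ring
      refine f1.trans (hs.diagSimilar_descent h2 hd' han₁ han'
        ![![v 0, v 1, v 2 / s], ![p₁ 0, p₁ 1, p₁ 2 / s],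
          ![p₀ 0 / algebraMap k L y, p₀ 1 / algebraMap k L y, p₀ 2 / (s * algebraMap k L y)]] ?_)
      have hsq := hs.sq
      have hdy' := congrArg (algebraMap k L) hdy
      simp only [map_mul, map_pow, ← hsq] at hdy'
      simp only [diagQ, diagB, Fin.sum_univ_three, Matrix.cons_val, map_mul] at e1 e2 e3 e4 e5 e6
      intro i j
      simp only [diagB, Fin.sum_univ_three, Matrix.cons_val, map_mul, ← hsq]
      fin_cases i <;> fin_cases j <;> simp <;> field_simp
      · linear_combination e1
      · linear_combination e4
      · linear_combination e5
      · linear_combination e4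
      · linear_combination e2
      · linear_combination e6
      · linear_combination e5
      · linear_combination e6
      · linear_combination e3 + algebraMap k L A * algebraMap k L B * hdy' +
          algebraMap k L A * algebraMap k L B * algebraMap k L y ^ 2 * hsq
    · exfalso
      have hdx : d = x ^ 2 := by rw [← f1]; ring
      obtain ⟨v, p₁, p₀, e1, e2, e3, e4, e5, e6⟩ := subform_theorem (L := k) h2 A' B' 0
        (A' * B' * d') A B d x hdx.symm hd (diagAniso_of_sq (s := x) (hdx ▸ han)) P' hP' hP3'
      obtain ⟨z, hz⟩ := isSquare_of_frame (L := k) (a := A') (b := B') (A := A) (B := B) (d := d')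
        hAB' v p₁ p₀ e1 e2 e3 e4 e5 e6
      exact hsq ⟨z, by rw [← hz, sq]⟩

/-- If `⟨1, A, B, ABd⟩` is anisotropic and has a zero modulo `reducedPoly a α β γ`, then the
quadratic form of this polynomial is anisotropic. -/
theorem anisotropic_of_hasZeroModulo (h2 : (2 : k) ≠ 0) {a α β γ A B d : k}
    (ha : a ≠ 0) (hdet : α * γ - β ^ 2 ≠ 0) (han : DiagAniso ![1, A, B, A * B * d])
    (hdom : HasZeroModulo a α β γ A B d) (x₀ x₁ x₂ x₃ : k)
    (hx : x₀ ^ 2 + a * x₁ ^ 2 + α * x₂ ^ 2 + 2 * β * (x₂ * x₃) + γ * x₃ ^ 2 = 0) :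
    x₀ = 0 ∧ x₁ = 0 ∧ x₂ = 0 ∧ x₃ = 0 := by
  have hABd : A * B * d ≠ 0 := han.ne_zero 3
  have hd : d ≠ 0 := right_ne_zero_of_mul hABd
  obtain ⟨P, hP, hP3⟩ := hdom
  obtain ⟨L, _, _, s, hs, hanL⟩ : ∃ (L : Type _) (_ : Field L) (_ : Algebra k L) (s : L),
      s ^ 2 = algebraMap k L d ∧ DiagAniso ![1, algebraMap k L A, algebraMap k L B,
        algebraMap k L A * algebraMap k L B] := by
    by_cases hsq : IsSquare d
    · obtain ⟨s, hs⟩ := hsq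
      rw [← sq] at hs
      exact ⟨k, inferInstance, inferInstance, s, hs.symm, diagAniso_of_sq (s := s) (hs ▸ han)⟩
    · obtain ⟨L, _, _, s, hs⟩ := exists_isQuadExt d hsq
      exact ⟨L, inferInstance, inferInstance, s, hs.sq, hs.diagAniso h2 han⟩
  have h2L : (2 : L) ≠ 0 := by
    have := (algebraMap k L).injective.ne h2
    rwa [map_ofNat, map_zero] at this
  obtain ⟨v, p₁, p₀, e1, e2, e3, e4, e5, e6⟩ := subform_theorem h2L a α β γ A B d s hs hd hanL
    P hP hP3
  set w := ![algebraMap k L A, algebraMap k L B, algebraMap k L A * algebraMap k L B] with hw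
  set y : Fin 3 → L := fun i => algebraMap k L x₁ * v i + algebraMap k L x₂ * p₁ i +
    algebraMap k L x₃ * p₀ i with hy
  have hxL := congrArg (algebraMap k L) hx
  rw [diagAniso_four_iff] at hanL
  have h0 := hanL (algebraMap k L x₀) (y 0) (y 1) (y 2) (by
    simp only [map_add, map_mul, map_pow, map_ofNat, map_zero, ← e1, ← e2, ← e3, ← e6] at hxL
    simp only [hw, diagQ, diagB, Fin.sum_univ_three, Matrix.cons_val] at hxL e4 e5
    simp only [hy]
    linear_combination hxL + 2 * algebraMap k L x₁ * algebraMap k L x₂ * e4 +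
      2 * algebraMap k L x₁ * algebraMap k L x₃ * e5)
  have hy0 : ∀ u, diagB w u y = 0 := by
    intro u
    simp [diagB, Fin.sum_univ_three, h0.2]
  have hlin : ∀ u, algebraMap k L x₁ * diagB w u v + algebraMap k L x₂ * diagB w u p₁ +
      algebraMap k L x₃ * diagB w u p₀ = 0 := by
    intro u
    rw [← hy0 u]
    simp only [diagB, Fin.sum_univ_three, hy]
    ring
  have g1 := hlin v
  have g2 := hlin p₁
  have g3 := hlin p₀
  rw [diagB_self, e1, e4, e5] at g1
  rw [diagB_comm, e4, diagB_self, e2, e6] at g2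
  rw [diagB_comm, e5, diagB_comm, e6, diagB_self, e3] at g3
  have inj := (algebraMap k L).injective
  have g1' : x₁ * a = 0 := by apply inj; simpa using g1
  have g2' : x₂ * α + x₃ * β = 0 := by apply inj; simpa using g2
  have g3' : x₂ * β + x₃ * γ = 0 := by apply inj; simpa using g3
  refine ⟨by simpa using h0.1, by simpa [ha] using g1', ?_, ?_⟩
  · have : x₂ * (α * γ - β ^ 2) = 0 := by linear_combination γ * g2' - β * g3'
    exact (mul_eq_zero.mp this).resolve_right hdet
  · have : x₃ * (α * γ - β ^ 2) = 0 := by linear_combination α * g3' - β * g2'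
    exact (mul_eq_zero.mp this).resolve_right hdet

end DiagonalCase

section Congruence

open Matrix

/-- The value `vᵀ T v` of the quadratic form with matrix `T`. -/
def matQ {R : Type*} [CommRing R] (T : Matrix (Fin 4) (Fin 4) R) (v : Fin 4 → R) : R :=
  v ⬝ᵥ T *ᵥ v

theorem matQ_congr {R : Type*} [CommRing R] (T M : Matrix (Fin 4) (Fin 4) R) (v : Fin 4 → R) :
    matQ (Mᵀ * T * M) v = matQ T (M *ᵥ v) := by
  rw [matQ, matQ, ← mulVec_mulVec, ← mulVec_mulVec, dotProduct_mulVec, vecMul_transpose]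

theorem matQ_smul {R : Type*} [CommRing R] (T : Matrix (Fin 4) (Fin 4) R) (c : R)
    (v : Fin 4 → R) : matQ (c • T) v = c * matQ T v := by
  simp [matQ, smul_mulVec]

theorem matQ_smul_vec {R : Type*} [CommRing R] (T : Matrix (Fin 4) (Fin 4) R) (c : R)
    (v : Fin 4 → R) : matQ T (c • v) = c ^ 2 * matQ T v := by
  simp [matQ, mulVec_smul]
  ring

theorem map_matQ {R S : Type*} [CommRing R] [CommRing S] (f : R →+* S)
    (T : Matrix (Fin 4) (Fin 4) R) (v : Fin 4 → R) :
    f (matQ T v) = matQ (T.map f) (fun i => f (v i)) := by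
  simp [matQ, mulVec, dotProduct]

theorem matQ_diagonal {R : Type*} [CommRing R] (w v : Fin 4 → R) :
    matQ (diagonal w) v = diagQ w v := by
  simp only [matQ, diagQ, dotProduct, mulVec_diagonal]
  exact Finset.sum_congr rfl fun i _ => by ring

variable {k : Type*} [Field k]

/-- Congruence of matrices by affine coordinate changes. -/
def AffCongr (S T : Matrix (Fin 4) (Fin 4) k) : Prop :=
  ∃ M : Matrix (Fin 4) (Fin 4) k, IsUnit M.det ∧ M 3 = Pi.single 3 1 ∧ Mᵀ * S * M = T

theorem AffCongr.trans {S T U : Matrix (Fin 4) (Fin 4) k} (h : AffCongr S T)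
    (h' : AffCongr T U) : AffCongr S U := by
  obtain ⟨M, hM, hM3, rfl⟩ := h
  obtain ⟨N, hN, hN3, rfl⟩ := h'
  refine ⟨M * N, by rw [det_mul]; exact hM.mul hN, ?_, ?_⟩
  · have : (M * N) 3 = M 3 ᵥ* N := rfl
    rw [this, hM3, single_one_vecMul, ← hN3]
    rfl
  · rw [transpose_mul]
    simp only [Matrix.mul_assoc]

theorem inv_last_row {M : Matrix (Fin 4) (Fin 4) k} (hM : IsUnit M.det)
    (hM3 : M 3 = Pi.single 3 1) : M⁻¹ 3 = Pi.single 3 1 := by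
  have h1 : (M * M⁻¹) 3 = M 3 ᵥ* M⁻¹ := rfl
  rw [hM3, single_one_vecMul, mul_nonsing_inv _ hM] at h1
  have h2 : (1 : Matrix (Fin 4) (Fin 4) k) 3 = Pi.single 3 1 := by
    funext j
    rw [one_apply, Pi.single_apply]
    simp [eq_comm]
  rw [← h2, h1]
  rfl

theorem AffCongr.anisotropic {S T : Matrix (Fin 4) (Fin 4) k} (h : AffCongr S T)
    (hT : ∀ v, matQ T v = 0 → v = 0) (v : Fin 4 → k) (hv : matQ S v = 0) : v = 0 := by
  obtain ⟨M, hM, -, rfl⟩ := h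
  have h1 : M *ᵥ (M⁻¹ *ᵥ v) = v := by rw [mulVec_mulVec, mul_nonsing_inv _ hM, one_mulVec]
  have h2 := hT (M⁻¹ *ᵥ v) (by rw [matQ_congr, h1, hv])
  rw [← h1, h2, mulVec_zero]

theorem AffCongr.anisotropic_right {S T : Matrix (Fin 4) (Fin 4) k} (h : AffCongr S T)
    (hS : ∀ v, matQ S v = 0 → v = 0) (v : Fin 4 → k) (hv : matQ T v = 0) : v = 0 := by
  obtain ⟨M, hM, -, rfl⟩ := h
  have h1 : M⁻¹ *ᵥ (M *ᵥ v) = v := by rw [mulVec_mulVec, nonsing_inv_mul _ hM, one_mulVec]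
  rw [matQ_congr] at hv
  rw [← h1, hS _ hv, mulVec_zero]

theorem AffCongr.det_ne_zero {S T : Matrix (Fin 4) (Fin 4) k} (h : AffCongr S T)
    (hS : S.det ≠ 0) : T.det ≠ 0 := by
  obtain ⟨M, hM, -, rfl⟩ := h
  simp [hM.ne_zero, hS]

end Congruence

section Domination

open Matrix MvPolynomial

variable {k : Type*} [Field k]

/-- The generic affine point `(X₀, X₁, X₂, 1)`. -/
def genPoint (k : Type*) [Field k] : Fin 4 → MvPolynomial (Fin 3) k := ![X 0, X 1, X 2, 1]

/-- The affine equation of the quadric with matrix `S`. -/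
def affPoly (S : Matrix (Fin 4) (Fin 4) k) : MvPolynomial (Fin 3) k :=
  matQ (S.map C) (genPoint k)

/-- The form with matrix `S'` has a zero with nonzero last coordinate over the coordinate ring of
the affine quadric with matrix `S`. -/
def Dominates (S S' : Matrix (Fin 4) (Fin 4) k) : Prop :=
  ∃ P : Fin 4 → MvPolynomial (Fin 3) k,
    affPoly S ∣ matQ (S'.map C) P ∧ (affPoly S ∣ P 3 → affPoly S ∣ 1)

/-- The polynomial endomorphism given by an affine coordinate change. -/
def affSubst (M : Matrix (Fin 4) (Fin 4) k) : MvPolynomial (Fin 3) k →ₐ[k] MvPolynomial (Fin 3) k :=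
  aeval ![(M.map C *ᵥ genPoint k) 0, (M.map C *ᵥ genPoint k) 1,
    (M.map C *ᵥ genPoint k) 2]

theorem map_C_mulVec_last {M : Matrix (Fin 4) (Fin 4) k} (hM3 : M 3 = Pi.single 3 1)
    (P : Fin 4 → MvPolynomial (Fin 3) k) : (M.map C *ᵥ P) 3 = P 3 := by
  simp [mulVec, dotProduct, Fin.sum_univ_four, hM3]

theorem affSubst_genPoint {M : Matrix (Fin 4) (Fin 4) k} (hM3 : M 3 = Pi.single 3 1) :
    (fun i => affSubst M (genPoint k i)) = M.map C *ᵥ genPoint k := by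
  funext i
  fin_cases i
  · simp [affSubst, genPoint]
  · simp [affSubst, genPoint]
  · simp [affSubst, genPoint]
  · have := map_C_mulVec_last hM3 (genPoint k)
    simp [this]
    simp [genPoint]

theorem affSubst_matQ (M S : Matrix (Fin 4) (Fin 4) k) (P : Fin 4 → MvPolynomial (Fin 3) k) :
    affSubst M (matQ (S.map C) P) = matQ (S.map C) (fun i => affSubst M (P i)) := by
  have h := map_matQ (affSubst M).toRingHom (S.map C) P
  have h1 : (S.map C).map (affSubst M).toRingHom = S.map C := by
    ext i j : 2
    simp [affSubst]
  rw [h1] at h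
  exact h

theorem affSubst_affPoly {M : Matrix (Fin 4) (Fin 4) k} (hM3 : M 3 = Pi.single 3 1)
    (S : Matrix (Fin 4) (Fin 4) k) : affSubst M (affPoly S) = affPoly (Mᵀ * S * M) := by
  rw [affPoly, affSubst_matQ, affSubst_genPoint hM3, affPoly, Matrix.map_mul, Matrix.map_mul,
    transpose_map, matQ_congr]

theorem affSubst_inv {M : Matrix (Fin 4) (Fin 4) k} (hM : IsUnit M.det)
    (hM3 : M 3 = Pi.single 3 1) (p : MvPolynomial (Fin 3) k) :
    affSubst M⁻¹ (affSubst M p) = p := by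
  have h3 := inv_last_row hM hM3
  have key : ∀ i, affSubst M⁻¹ ((M.map C *ᵥ genPoint k) i) = genPoint k i := by
    intro i
    have h1 : affSubst M⁻¹ ((M.map C *ᵥ genPoint k) i) =
        (M.map C *ᵥ fun j => affSubst M⁻¹ (genPoint k j)) i := by
      simp [mulVec, dotProduct, affSubst]
    rw [h1, affSubst_genPoint h3, mulVec_mulVec, ← Matrix.map_mul, mul_nonsing_inv _ hM,
      Matrix.map_one C C_0 C_1, one_mulVec]
  have : (affSubst M⁻¹).comp (affSubst M) = AlgHom.id k _ := by
    apply MvPolynomial.algHom_ext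
    intro i
    fin_cases i
    · simpa [affSubst, genPoint] using key 0
    · simpa [affSubst, genPoint] using key 1
    · simpa [affSubst, genPoint] using key 2
  exact DFunLike.congr_fun this p

theorem Dominates.congr_left {S T S' : Matrix (Fin 4) (Fin 4) k} (h : Dominates S S')
    (hT : AffCongr S T) : Dominates T S' := by
  obtain ⟨M, hM, hM3, rfl⟩ := hT
  obtain ⟨P, hP, hP3⟩ := h
  refine ⟨fun i => affSubst M (P i), ?_, fun hd => ?_⟩
  · rw [← affSubst_affPoly hM3, ← affSubst_matQ]
    exact map_dvd _ hP
  · rw [← affSubst_affPoly hM3] at hd ⊢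
    have h1 := map_dvd (affSubst M⁻¹) hd
    rw [affSubst_inv hM hM3, affSubst_inv hM hM3] at h1
    simpa using map_dvd (affSubst M) (hP3 h1)

theorem Dominates.congr_right {S S' T' : Matrix (Fin 4) (Fin 4) k} (h : Dominates S S')
    (hT : AffCongr S' T') : Dominates S T' := by
  obtain ⟨M, hM, hM3, rfl⟩ := hT
  obtain ⟨P, hP, hP3⟩ := h
  refine ⟨M⁻¹.map C *ᵥ P, ?_, ?_⟩
  · rw [Matrix.map_mul, Matrix.map_mul, transpose_map, matQ_congr, mulVec_mulVec,
      ← Matrix.map_mul, mul_nonsing_inv _ hM, Matrix.map_one C C_0 C_1, one_mulVec]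
    exact hP
  · rwa [map_C_mulVec_last (inv_last_row hM hM3)]

theorem matQ_map_C_smul (c : k) (S : Matrix (Fin 4) (Fin 4) k)
    (P : Fin 4 → MvPolynomial (Fin 3) k) :
    matQ ((c • S).map C) P = C c * matQ (S.map C) P := by
  rw [← matQ_smul]
  congr 1
  ext i j : 2
  simp

theorem affPoly_smul_dvd {c : k} (hc : c ≠ 0) (S : Matrix (Fin 4) (Fin 4) k)
    (p : MvPolynomial (Fin 3) k) : affPoly (c • S) ∣ p ↔ affPoly S ∣ p := by
  rw [affPoly, matQ_map_C_smul]
  exact IsUnit.mul_left_dvd (hc.isUnit.map C)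

theorem dominates_smul_iff {c c' : k} (hc : c ≠ 0) (hc' : c' ≠ 0)
    (S S' : Matrix (Fin 4) (Fin 4) k) : Dominates (c • S) (c' • S') ↔ Dominates S S' := by
  simp only [Dominates, affPoly_smul_dvd hc, matQ_map_C_smul]
  simp only [IsUnit.dvd_mul_left (hc'.isUnit.map C)]

/-- The normal form of a quadric equation. -/
def normalMatrix (a α β γ : k) : Matrix (Fin 4) (Fin 4) k :=
  !![1, 0, 0, 0; 0, a, 0, 0; 0, 0, α, β; 0, 0, β, γ]

theorem affPoly_normalMatrix (a α β γ : k) :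
    affPoly (normalMatrix a α β γ) = reducedPoly a α β γ := by
  simp [affPoly, matQ, normalMatrix, genPoint, reducedPoly, dotProduct, mulVec,
    Fin.sum_univ_four, show (C 2 : MvPolynomial (Fin 3) k) = 2 from map_ofNat C 2]
  ring

theorem hasZeroModulo_of_dominates {a α β γ A B d : k}
    (h : Dominates (normalMatrix a α β γ) (diagonal ![1, A, B, A * B * d])) :
    HasZeroModulo a α β γ A B d := by
  obtain ⟨P, hP, hP3⟩ := h
  rw [affPoly_normalMatrix] at hP hP3
  refine ⟨P, ?_, hP3⟩
  convert hP using 1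
  rw [diagonal_map (by simp), matQ_diagonal]
  simp [diagQ, Fin.sum_univ_four]

theorem diagonal_eq_normalMatrix (A B c : k) :
    diagonal ![1, A, B, c] = normalMatrix A B 0 c := by
  ext i j
  fin_cases i <;> fin_cases j <;> simp [normalMatrix]

end Domination

section NormalForm

open Matrix

variable {k : Type*} [Field k]

theorem exists_diagonalization (h2 : (2 : k) ≠ 0) {n : ℕ} (S : Matrix (Fin n) (Fin n) k)
    (hS : S.IsSymm) : ∃ N : Matrix (Fin n) (Fin n) k, IsUnit N.det ∧
      ∃ g : Fin n → k, Nᵀ * S * N = diagonal g := by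
  have := invertibleOfNonzero h2
  obtain ⟨v, hv⟩ := LinearMap.BilinForm.exists_orthogonal_basis (B := S.toBilin')
    (LinearMap.BilinForm.isSymm_iff.mp (Matrix.isSymm_toBilin'_iff_isSymm.mpr hS))
  set b := v.reindex (finCongr (Module.finrank_fin_fun k)) with hb
  have hN : ∀ i j, ((Pi.basisFun k (Fin n)).toMatrix b) i j = b j i := fun i j => by
    simp [Module.Basis.toMatrix_apply]
  have := (Pi.basisFun k (Fin n)).invertibleToMatrix b
  refine ⟨(Pi.basisFun k (Fin n)).toMatrix b, isUnit_det_of_invertible _,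
    fun i => b i ⬝ᵥ S *ᵥ b i, ?_⟩
  have hent : ∀ i j, (((Pi.basisFun k (Fin n)).toMatrix b)ᵀ * S *
      (Pi.basisFun k (Fin n)).toMatrix b) i j = b i ⬝ᵥ S *ᵥ b j := by
    intro i j
    rw [Matrix.mul_assoc]
    simp only [Matrix.mul_apply, transpose_apply, hN, dotProduct, mulVec]
  ext i j
  rw [hent]
  by_cases hij : i = j
  · subst hij
    simp
  · rw [diagonal_apply_ne _ hij, ← toBilin'_apply']
    have h1 := hv (i := (finCongr (Module.finrank_fin_fun k)).symm i)
      (j := (finCongr (Module.finrank_fin_fun k)).symm j) (by simpa using hij)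
    simpa [hb] using h1

/-- A symmetric matrix that is diagonal except for its last row and column. -/
def arrowMatrix (g₀ g₁ g₂ c₀ c₁ c₂ γ : k) : Matrix (Fin 4) (Fin 4) k :=
  !![g₀, 0, 0, c₀; 0, g₁, 0, c₁; 0, 0, g₂, c₂; c₀, c₁, c₂, γ]

theorem det_arrowMatrix (g₀ g₁ g₂ c₀ c₁ c₂ γ : k) : (arrowMatrix g₀ g₁ g₂ c₀ c₁ c₂ γ).det =
    g₀ * g₁ * g₂ * γ - c₀ ^ 2 * g₁ * g₂ - c₁ ^ 2 * g₀ * g₂ - c₂ ^ 2 * g₀ * g₁ := by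
  simp [arrowMatrix, det_succ_row_zero, Fin.sum_univ_succ, Fin.succAbove]
  ring

theorem exists_affCongr_arrowMatrix (h2 : (2 : k) ≠ 0) (S : Matrix (Fin 4) (Fin 4) k)
    (hS : S.IsSymm) :
    ∃ g₀ g₁ g₂ c₀ c₁ c₂ γ, AffCongr S (arrowMatrix g₀ g₁ g₂ c₀ c₁ c₂ γ) := by
  obtain ⟨N, hN, g, hg⟩ := exists_diagonalization h2 (S.submatrix Fin.castSucc Fin.castSucc)
    (hS.submatrix _)
  have hs : ∀ i j, S i j = S j i := fun i j => hS.apply j i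
  have hg' : ∀ i j, ∑ m, (∑ l, N l i * S l.castSucc m.castSucc) * N m j = diagonal g i j := by
    intro i j
    rw [← hg]
    simp [Matrix.mul_apply]
  refine ⟨g 0, g 1, g 2, ∑ l, N l 0 * S l.castSucc 3, ∑ l, N l 1 * S l.castSucc 3,
    ∑ l, N l 2 * S l.castSucc 3, S 3 3,
    !![N 0 0, N 0 1, N 0 2, 0; N 1 0, N 1 1, N 1 2, 0; N 2 0, N 2 1, N 2 2, 0; 0, 0, 0, 1],
    ?_, ?_, ?_⟩
  · convert hN using 1
    simp [det_succ_row_zero, Fin.sum_univ_succ, Fin.succAbove]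
  · funext j
    fin_cases j <;> simp
  · have c0 : Fin.castSucc (0 : Fin 3) = 0 := rfl
    have c1 : Fin.castSucc (1 : Fin 3) = 1 := rfl
    have c2 : Fin.castSucc (2 : Fin 3) = 2 := rfl
    simp only [Fin.sum_univ_three, c0, c1, c2] at hg'
    ext i j
    fin_cases i <;> fin_cases j <;>
      simp [arrowMatrix, Matrix.mul_apply, Fin.sum_univ_four, Fin.sum_univ_three, hs 3, hg', c0,
        c1, c2] <;> ring

theorem affCongr_arrowMatrix_swap₀₂ (g₀ g₁ g₂ c₀ c₁ c₂ γ : k) :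
    AffCongr (arrowMatrix g₀ g₁ g₂ c₀ c₁ c₂ γ) (arrowMatrix g₂ g₁ g₀ c₂ c₁ c₀ γ) := by
  refine ⟨!![0, 0, 1, 0; 0, 1, 0, 0; 1, 0, 0, 0; 0, 0, 0, 1], ?_, ?_, ?_⟩
  · simp [det_succ_row_zero, Fin.sum_univ_succ, Fin.succAbove]
  · funext j
    fin_cases j <;> simp
  · ext i j
    fin_cases i <;> fin_cases j <;> simp [arrowMatrix, Matrix.mul_apply, Fin.sum_univ_four]

theorem affCongr_arrowMatrix_swap₁₂ (g₀ g₁ g₂ c₀ c₁ c₂ γ : k) :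
    AffCongr (arrowMatrix g₀ g₁ g₂ c₀ c₁ c₂ γ) (arrowMatrix g₀ g₂ g₁ c₀ c₂ c₁ γ) := by
  refine ⟨!![1, 0, 0, 0; 0, 0, 1, 0; 0, 1, 0, 0; 0, 0, 0, 1], ?_, ?_, ?_⟩
  · simp [det_succ_row_zero, Fin.sum_univ_succ, Fin.succAbove]
  · funext j
    fin_cases j <;> simp
  · ext i j
    fin_cases i <;> fin_cases j <;> simp [arrowMatrix, Matrix.mul_apply, Fin.sum_univ_four]

theorem affCongr_arrowMatrix_normalMatrix {g₀ g₁ : k} (h₀ : g₀ ≠ 0) (h₁ : g₁ ≠ 0)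
    (g₂ c₀ c₁ c₂ γ : k) : AffCongr (arrowMatrix g₀ g₁ g₂ c₀ c₁ c₂ γ)
      (g₀ • normalMatrix (g₁ / g₀) (g₂ / g₀) (c₂ / g₀)
        ((γ - c₀ ^ 2 / g₀ - c₁ ^ 2 / g₁) / g₀)) := by
  refine ⟨!![1, 0, 0, -c₀ / g₀; 0, 1, 0, -c₁ / g₁; 0, 0, 1, 0; 0, 0, 0, 1], ?_, ?_, ?_⟩
  · simp [det_succ_row_zero, Fin.sum_univ_succ, Fin.succAbove]
  · funext j
    fin_cases j <;> simp
  · ext i j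
    fin_cases i <;> fin_cases j <;>
      simp [arrowMatrix, normalMatrix, Matrix.mul_apply, Fin.sum_univ_four] <;> field_simp <;> ring

theorem exists_affCongr_normalMatrix (h2 : (2 : k) ≠ 0) (S : Matrix (Fin 4) (Fin 4) k)
    (hS : S.IsSymm) (hdet : S.det ≠ 0) :
    ∃ c a α β γ : k, c ≠ 0 ∧ a ≠ 0 ∧ α * γ - β ^ 2 ≠ 0 ∧
      AffCongr S (c • normalMatrix a α β γ) := by
  obtain ⟨g₀, g₁, g₂, c₀, c₁, c₂, γ, h0, h1, h⟩ : ∃ g₀ g₁ g₂ c₀ c₁ c₂ γ : k,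
      g₀ ≠ 0 ∧ g₁ ≠ 0 ∧ AffCongr S (arrowMatrix g₀ g₁ g₂ c₀ c₁ c₂ γ) := by
    obtain ⟨g₀, g₁, g₂, c₀, c₁, c₂, γ, h⟩ := exists_affCongr_arrowMatrix h2 S hS
    have hd := h.det_ne_zero hdet
    rw [det_arrowMatrix] at hd
    by_cases h0 : g₀ = 0
    · refine ⟨_, _, _, _, _, _, _, ?_, ?_, h.trans (affCongr_arrowMatrix_swap₀₂ ..)⟩
      · rintro rfl
        simp [h0] at hd
      · rintro rfl
        simp [h0] at hd
    · by_cases h1 : g₁ = 0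
      · refine ⟨_, _, _, _, _, _, _, h0, ?_, h.trans (affCongr_arrowMatrix_swap₁₂ ..)⟩
        rintro rfl
        simp [h1] at hd
      · exact ⟨_, _, _, _, _, _, _, h0, h1, h⟩
  have h' := h.trans (affCongr_arrowMatrix_normalMatrix h0 h1 g₂ c₀ c₁ c₂ γ)
  refine ⟨_, _, _, _, _, h0, div_ne_zero h1 h0, ?_, h'⟩
  intro hz
  apply h'.det_ne_zero hdet
  rw [det_smul]
  have : ∀ a α β γ : k, (normalMatrix a α β γ).det = a * (α * γ - β ^ 2) := by
    intro a α β γ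
    simp [normalMatrix, det_succ_row_zero, Fin.sum_univ_succ, Fin.succAbove]
    left
    ring
  rw [this, hz]
  simp

theorem matQ_normalMatrix (a α β γ : k) (x : Fin 4 → k) :
    matQ (normalMatrix a α β γ) x =
      x 0 ^ 2 + a * x 1 ^ 2 + α * x 2 ^ 2 + 2 * β * (x 2 * x 3) + γ * x 3 ^ 2 := by
  simp [matQ, normalMatrix, dotProduct, mulVec, Fin.sum_univ_four]
  ring

theorem affCongr_normalMatrix_diagonal {a α : k} (c β γ : k) (ha : a ≠ 0) (hα : α ≠ 0) :
    AffCongr (c • normalMatrix a α β γ)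
      (c • diagonal ![1, a, α, a * α * ((γ - β ^ 2 / α) / (a * α))]) := by
  refine ⟨!![1, 0, 0, 0; 0, 1, 0, 0; 0, 0, 1, -β / α; 0, 0, 0, 1], ?_, ?_, ?_⟩
  · simp [det_succ_row_zero, Fin.sum_univ_succ, Fin.succAbove]
  · funext j
    fin_cases j <;> simp
  · ext i j
    fin_cases i <;> fin_cases j <;>
      simp [normalMatrix, Matrix.mul_apply, Fin.sum_univ_four] <;> field_simp <;> ring

theorem exists_affCongr_diagonal (h2 : (2 : k) ≠ 0) (S : Matrix (Fin 4) (Fin 4) k)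
    (hS : S.IsSymm) (hdet : S.det ≠ 0) (han : ∀ v, matQ S v = 0 → v = 0) :
    ∃ c A B d : k, c ≠ 0 ∧ DiagAniso ![1, A, B, A * B * d] ∧
      AffCongr S (c • diagonal ![1, A, B, A * B * d]) := by
  obtain ⟨c, a, α, β, γ, hc, ha, -, h⟩ := exists_affCongr_normalMatrix h2 S hS hdet
  have hα : α ≠ 0 := by
    rintro rfl
    have := congrFun (h.anisotropic_right han (Pi.single 2 1) (by
      rw [matQ_smul, matQ_normalMatrix]
      simp)) 2
    simp at this
  have h' := h.trans (affCongr_normalMatrix_diagonal c β γ ha hα)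
  refine ⟨c, a, α, _, hc, fun v hv => ?_, h'⟩
  apply h'.anisotropic_right han
  rw [matQ_smul, matQ_diagonal, hv, mul_zero]

/-- Quaternary forms, one of them anisotropic, that have zeros over each other's affine quadrics
are similar. -/
theorem similar_of_dominates (h2 : (2 : k) ≠ 0) (S S' : Matrix (Fin 4) (Fin 4) k)
    (hS : S.IsSymm) (hS' : S'.IsSymm) (hdet : S.det ≠ 0) (hdet' : S'.det ≠ 0)
    (han : ∀ v, matQ S v = 0 → v = 0) (h : Dominates S S') (h' : Dominates S' S) :
    ∃ c : k, c ≠ 0 ∧ ∃ G : Matrix (Fin 4) (Fin 4) k, ∀ x, matQ S' (G *ᵥ x) = c * matQ S x := by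
  obtain ⟨c, A, B, d, hc, hD, hSD⟩ := exists_affCongr_diagonal h2 S hS hdet han
  have han' : ∀ v, matQ S' v = 0 → v = 0 := by
    obtain ⟨c', a, α, β, γ, hc', ha, hαγ, hSN⟩ := exists_affCongr_normalMatrix h2 S' hS' hdet'
    have hz := hasZeroModulo_of_dominates
      ((dominates_smul_iff hc' hc _ _).mp ((h'.congr_left hSN).congr_right hSD))
    refine hSN.anisotropic fun v hv => ?_
    rw [matQ_smul, matQ_normalMatrix] at hv
    obtain ⟨h0, h1, h2, h3⟩ := anisotropic_of_hasZeroModulo h2 ha hαγ hD hz (v 0) (v 1) (v 2) (v 3)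
      ((mul_eq_zero.mp hv).resolve_left hc')
    funext i
    fin_cases i <;> assumption
  obtain ⟨c', A', B', d', hc', hD', hSD'⟩ := exists_affCongr_diagonal h2 S' hS' hdet' han'
  have hz := (dominates_smul_iff hc hc' _ _).mp ((h.congr_left hSD).congr_right hSD')
  have hz' := (dominates_smul_iff hc' hc _ _).mp ((h'.congr_left hSD').congr_right hSD)
  obtain ⟨e, he, G, hG⟩ := diagSimilar_of_hasZeroModulo h2 hD hD'
    (hasZeroModulo_of_dominates (by rw [← diagonal_eq_normalMatrix]; exact hz))
    (hasZeroModulo_of_dominates (by rw [← diagonal_eq_normalMatrix]; exact hz'))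
  obtain ⟨M, hM, -, hMS⟩ := hSD
  obtain ⟨M', -, -, hMS'⟩ := hSD'
  refine ⟨c' * e / c, div_ne_zero (mul_ne_zero hc' he) hc, M' * (G * M⁻¹), fun x => ?_⟩
  have hx : matQ S x = c * diagQ ![1, A, B, A * B * d] (M⁻¹ *ᵥ x) := by
    rw [← matQ_diagonal, ← matQ_smul, ← hMS, matQ_congr, mulVec_mulVec, mul_nonsing_inv M hM,
      one_mulVec]
  rw [← mulVec_mulVec, ← mulVec_mulVec, ← matQ_congr, hMS', matQ_smul, matQ_diagonal, hG, hx]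
  field_simp

end NormalForm

section Transfer

open Matrix MvPolynomial

theorem matQ_polarMatrix {k : Type*} [CommRing k] (q : QuadraticForm k (Fin 4 → k))
    (v : Fin 4 → k) : matQ (polarMatrix q) v = 2 * q v := by
  have h : polarMatrix q = LinearMap.toMatrix₂' k q.polarBilin := by
    ext i j
    simp [polarMatrix, LinearMap.toMatrix₂'_apply]
  rw [matQ, h, ← Matrix.toLinearMap₂'_apply', Matrix.toLinearMap₂'_toMatrix',
    QuadraticMap.polarBilin_apply_apply, QuadraticMap.polar_self, two_nsmul, two_mul]

theorem toQuadraticForm'_eq_matQ {R : Type*} [CommRing R] (T : Matrix (Fin 4) (Fin 4) R)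
    (v : Fin 4 → R) : T.toQuadraticForm' v = matQ T v :=
  Matrix.toLinearMap₂'_apply' T v v

theorem polarMatrix_isSymm {k : Type*} [CommRing k] {n : ℕ} (q : QuadraticForm k (Fin n → k)) :
    (polarMatrix q).IsSymm := by
  ext i j
  exact QuadraticMap.polar_comm _ _ _

variable {k : Type*} [Field k]

theorem affPoly_polarMatrix (q : QuadraticForm k (Fin 4 → k)) :
    affPoly (polarMatrix q) = C 2 * affineQuadricPoly q := by
  have hv : (fun i : Fin 4 => if h : (i : ℕ) < 4 - 1 then (X ⟨i, h⟩ : MvPolynomial (Fin 3) k)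
      else 1) = genPoint k := by
    funext i
    fin_cases i <;> simp [genPoint]
  have hq : affineQuadricPoly q = matQ ((coeffMatrix q).map C) (genPoint k) := by
    rw [← hv]
    exact toQuadraticForm'_eq_matQ _ _
  have hs : ∀ x : Fin 4 → k, QuadraticMap.polar q x x = 2 * q x := fun x => by
    rw [QuadraticMap.polar_self, two_nsmul, two_mul]
  have hC : (C 2 : MvPolynomial (Fin 3) k) = 2 := map_ofNat C 2
  rw [hq, affPoly]
  simp only [matQ, dotProduct, mulVec, Fin.sum_univ_four, map_apply, polarMatrix, coeffMatrix,
    of_apply, hs, map_mul, QuadraticMap.polar_comm q (Pi.single 1 1) (Pi.single 0 1),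
    QuadraticMap.polar_comm q (Pi.single 2 1) (Pi.single 0 1),
    QuadraticMap.polar_comm q (Pi.single 3 1) (Pi.single 0 1),
    QuadraticMap.polar_comm q (Pi.single 2 1) (Pi.single 1 1),
    QuadraticMap.polar_comm q (Pi.single 3 1) (Pi.single 1 1),
    QuadraticMap.polar_comm q (Pi.single 3 1) (Pi.single 2 1)]
  simp [hC]
  ring

theorem affPoly_polarMatrix_dvd_iff (h2 : (2 : k) ≠ 0) (q : QuadraticForm k (Fin 4 → k))
    (p : MvPolynomial (Fin 3) k) : affPoly (polarMatrix q) ∣ p ↔ affineQuadricPoly q ∣ p := by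
  rw [affPoly_polarMatrix]
  exact ((isUnit_iff_ne_zero.mpr h2).map C).mul_left_dvd

theorem map_matQ_map_C {A : Type*} [CommRing A] [Algebra k A] (φ : MvPolynomial (Fin 3) k →ₐ[k] A)
    (S : Matrix (Fin 4) (Fin 4) k) (P : Fin 4 → MvPolynomial (Fin 3) k) :
    φ (matQ (S.map C) P) = matQ (S.map (algebraMap k A)) fun i => φ (P i) := by
  have hS : (S.map C).map φ = S.map (algebraMap k A) := by
    ext i j
    exact φ.commutes _
  rw [← hS]
  exact map_matQ φ.toRingHom (S.map C) P

/-- A morphism of function fields in the direction of `q'` gives a zero of `q'` modulo the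
equation of `q`. -/
theorem dominates_of_algHom (h2 : (2 : k) ≠ 0) {q q' : QuadraticForm k (Fin 4 → k)}
    (e : quadricFunctionField q' →ₐ[k] quadricFunctionField q) :
    Dominates (polarMatrix q) (polarMatrix q') := by
  let R := quadricCoordRing q
  let K := quadricFunctionField q
  let π : MvPolynomial (Fin 3) k →ₐ[k] R := Ideal.Quotient.mkₐ k _
  let ψ : MvPolynomial (Fin 3) k →ₐ[k] K := e.comp
    ((IsScalarTower.toAlgHom k (quadricCoordRing q') (quadricFunctionField q')).comp
      (Ideal.Quotient.mkₐ k _))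
  have hπ : ∀ p, π p = 0 ↔ affPoly (polarMatrix q) ∣ p := fun p => by
    rw [affPoly_polarMatrix_dvd_iff h2, ← Ideal.mem_span_singleton]
    exact Ideal.Quotient.eq_zero_iff_mem
  have hψ : ψ (affPoly (polarMatrix q')) = 0 := by
    have : Ideal.Quotient.mkₐ k (Ideal.span {affineQuadricPoly q'})
        (affPoly (polarMatrix q')) = 0 := by
      refine Ideal.Quotient.eq_zero_iff_mem.mpr (Ideal.mem_span_singleton.mpr ?_)
      rw [← affPoly_polarMatrix_dvd_iff h2]
    simp only [ψ, AlgHom.comp_apply]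
    erw [this]
    simp
  obtain ⟨b, hb⟩ := IsLocalization.exist_integer_multiples_of_finite (nonZeroDivisors R)
    fun i => ψ (genPoint k i)
  choose p hp using hb
  choose P hP using fun i => Ideal.Quotient.mk_surjective (p i)
  replace hP : ∀ i, π (P i) = p i := hP
  have hp' : ∀ i, algebraMap R K (π (P i)) = algebraMap R K b * ψ (genPoint k i) := fun i => by
    rw [hP, ← Algebra.smul_def]
    exact hp i
  refine ⟨P, ?_, fun h => ?_⟩
  · rw [← hπ]
    apply IsFractionRing.injective R K
    have h1 := map_matQ_map_C ((IsScalarTower.toAlgHom k R K).comp π) (polarMatrix q') P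
    have hv : (fun i => ((IsScalarTower.toAlgHom k R K).comp π) (P i)) =
        algebraMap R K b • fun i => ψ (genPoint k i) := funext hp'
    rw [hv, matQ_smul_vec, ← map_matQ_map_C] at h1
    refine h1.trans ?_
    erw [hψ]
    rw [mul_zero, map_zero]
  · rw [← hπ] at h ⊢
    have h3 := hp' 3
    have h4 : genPoint k 3 = 1 := rfl
    rw [h, h4, map_one ψ, mul_one] at h3
    have h5 : (b : R) = 0 := (IsFractionRing.injective R K h3).symm
    rw [map_one]
    exact b.2.2 1 (by rw [h5, mul_zero])

end Transfer

theorem stmt_7 (k : Type u) [Field k] (h2 : (2 : k) ≠ 0)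
    (q q' : QuadraticForm k (Fin 4 → k)) (hq : NondegQF q) (hq' : NondegQF q')
    (han : q.Anisotropic)
    (hiso : Nonempty (quadricFunctionField q ≃ₐ[k] quadricFunctionField q')) :
    SimilarQF q q' := by
  obtain ⟨e⟩ := hiso
  have han' : ∀ v, q v = 0 → v = 0 := han
  obtain ⟨c, hc, G, hG⟩ := similar_of_dominates h2 (polarMatrix q) (polarMatrix q')
    (polarMatrix_isSymm q) (polarMatrix_isSymm q') hq hq'
    (fun v hv => han' v (by simpa [matQ_polarMatrix, h2] using hv))
    (dominates_of_algHom h2 e.symm.toAlgHom) (dominates_of_algHom h2 e.toAlgHom)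
  have hG' : ∀ x, q' (G.mulVec x) = c * q x := fun x => by
    have := hG x
    rw [matQ_polarMatrix, matQ_polarMatrix, mul_left_comm] at this
    exact mul_left_cancel₀ h2 this
  have hinj : Function.Injective G.mulVecLin := by
    refine (injective_iff_map_eq_zero _).mpr fun x hx => han' x ?_
    have := hG' x
    rw [← Matrix.mulVecLin_apply, hx, QuadraticMap.map_zero] at this
    simpa [hc] using this.symm
  exact ⟨c, isUnit_iff_ne_zero.mpr hc,
    ⟨⟨LinearEquiv.ofInjectiveEndo G.mulVecLin hinj, fun x => by simpa using hG' x⟩⟩⟩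

end
end

section
/- (Wadsworth) Let q and q′ be nondegenerate quadratic forms of rank 4 over a field k of characteristic ≠ 2 with equal discriminants d(q) = d(q′) = d, where d is not a square in k. Let l = k(√d). If the base changes q_l and q′_l are similar as quadratic forms over l, then q and q′ are already similar over k. -/
open scoped TensorProduct
open Quaternion
set_option synthInstance.maxHeartbeats 1000000
set_option maxHeartbeats 1000000
noncomputable section

universe u v

open Matrix

/-- Two square matrices are similar as Gram matrices: congruent up to a nonzero scalar. -/
def GramSimilar {k : Type*} [Field k] {n : ℕ} (P Q : Matrix (Fin n) (Fin n) k) : Prop :=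
  ∃ c : k, c ≠ 0 ∧ ∃ T : Matrix (Fin n) (Fin n) k, T.det ≠ 0 ∧ Tᵀ * Q * T = c • P

namespace GramSimilar

variable {k : Type*} [Field k] {n : ℕ} {P Q R : Matrix (Fin n) (Fin n) k}

theorem symm (h : GramSimilar P Q) : GramSimilar Q P := by
  obtain ⟨c, hc, T, hT, e⟩ := h
  have hu : IsUnit T.det := isUnit_iff_ne_zero.mpr hT
  have hut : IsUnit Tᵀ.det := by rwa [det_transpose]
  refine ⟨c⁻¹, inv_ne_zero hc, T⁻¹, ?_, ?_⟩
  · rw [det_nonsing_inv]; exact (IsUnit.ringInverse hu).ne_zero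
  · have : P = c⁻¹ • (Tᵀ * Q * T) := by rw [e, smul_smul, inv_mul_cancel₀ hc, one_smul]
    rw [this, Matrix.mul_smul, Matrix.smul_mul, transpose_nonsing_inv]
    simp only [Matrix.mul_assoc, mul_nonsing_inv T hu, Matrix.mul_one,
      nonsing_inv_mul_cancel_left _ _ hut]

theorem trans (h : GramSimilar P Q) (h' : GramSimilar Q R) : GramSimilar P R := by
  obtain ⟨c, hc, T, hT, e⟩ := h
  obtain ⟨c', hc', T', hT', e'⟩ := h'
  refine ⟨c' * c, mul_ne_zero hc' hc, T' * T, ?_, ?_⟩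
  · rw [det_mul]; exact mul_ne_zero hT' hT
  · calc (T' * T)ᵀ * R * (T' * T) = Tᵀ * (T'ᵀ * R * T') * T := by
          simp only [transpose_mul, Matrix.mul_assoc]
      _ = (c' * c) • P := by
          rw [e', Matrix.mul_smul, Matrix.smul_mul, e, smul_smul]

theorem map {l : Type*} [Field l] (f : k →+* l) (h : GramSimilar P Q) :
    GramSimilar (P.map f) (Q.map f) := by
  obtain ⟨c, hc, T, hT, e⟩ := h
  refine ⟨f c, by simpa using hc, T.map f, ?_, ?_⟩
  · have : (T.map f).det = f T.det := by rw [RingHom.map_det]; rfl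
    rw [this]; simpa using hT
  · rw [← transpose_map, ← Matrix.map_mul, ← Matrix.map_mul, e]
    ext i j; simp

end GramSimilar

/-- Gram matrix of the diagonal form `⟨1, a, b, abd⟩`. -/
def normalGram {k : Type*} [Field k] (d a b : k) : Matrix (Fin 4) (Fin 4) k :=
  diagonal ![1, a, b, a * b * d]

/-- A congruence up to a scalar with a nonsingular target Gram matrix is a similarity. -/
theorem gramSimilar_of_congr {k : Type*} [Field k] {n : ℕ} {P Q T : Matrix (Fin n) (Fin n) k}
    {c : k} (hc : c ≠ 0) (hP : P.det ≠ 0) (e : Tᵀ * Q * T = c • P) : GramSimilar P Q := by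
  refine ⟨c, hc, T, fun h => ?_, e⟩
  have := congrArg det e
  rw [det_mul, h, mul_zero, det_smul] at this
  exact mul_ne_zero (pow_ne_zero _ hc) hP this.symm

/-- Over a quadratic extension `K = k(s)`, `s² = d`, an element of `k` that is a norm from
`K(√-e)` factors as a norm from `k(√-e)` times a norm from `k(√(-de))`. -/
theorem exists_norm_factorization {k K : Type*} [Field k] [Field K] [Algebra k K]
    (h2 : (2 : k) ≠ 0) {d : k} {s : K} (hs : s ^ 2 = algebraMap k K d)
    (hspan : ∀ z : K, ∃ x y : k, z = algebraMap k K x + algebraMap k K y * s)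
    (hind : ∀ x y : k, algebraMap k K x + algebraMap k K y * s = 0 → x = 0 ∧ y = 0)
    {c e : k} (he : e ≠ 0)
    {p r : K} (h : algebraMap k K c = p ^ 2 + algebraMap k K e * r ^ 2) :
    ∃ m n u v : k, c = (m ^ 2 + e * n ^ 2) * (u ^ 2 + d * e * v ^ 2) := by
  obtain ⟨p0, p1, rfl⟩ := hspan p
  obtain ⟨r0, r1, rfl⟩ := hspan r
  obtain ⟨h0, h1⟩ := hind (p0 ^ 2 + d * p1 ^ 2 + e * (r0 ^ 2 + d * r1 ^ 2) - c)
    (2 * (p0 * p1 + e * r0 * r1)) (by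
      simp only [map_add, map_sub, map_mul, map_pow, h, map_ofNat, ← hs]; ring)
  have h1 : p0 * p1 + e * r0 * r1 = 0 := by simpa [h2] using h1
  by_cases hn : p0 ^ 2 + e * r0 ^ 2 = 0
  · by_cases hr : r0 = 0
    · have hp : p0 = 0 := by simpa [hr] using hn
      subst hr hp
      exact ⟨e * r1, p1, 0, 1 / e, by field_simp; linear_combination -h0⟩
    · refine ⟨(c + 1) / 2, (c - 1) / 2 * (p0 / (e * r0)), 1, 0, ?_⟩
      field_simp
      linear_combination (-(c-1)^2) * hn
  · refine ⟨p0, r0, 1, (p0 * r1 - r0 * p1) / (p0 ^ 2 + e * r0 ^ 2), ?_⟩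
    field_simp
    have e1 : p1 * (p0 ^ 2 + e * r0 ^ 2) = -(e * r0 * (p0 * r1 - r0 * p1)) := by
      linear_combination p0 * h1
    linear_combination (-(p0 ^ 2 + e * r0 ^ 2)) * h0 + d * (p0 * p1 + e * r0 * r1) * h1

theorem gramSimilar_of_norm_factorization {k : Type*} [Field k] {d e x y m n u v : k}
    (hd : d ≠ 0) (he : e ≠ 0) (hx : x ≠ 0) (hy : y ≠ 0)
    (h : x * y = (m ^ 2 + e * n ^ 2) * (u ^ 2 + d * e * v ^ 2)) :
    GramSimilar (diagonal ![1, e, x, d * e * x]) (diagonal ![1, e, y, d * e * y]) := by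
  have hg : m ^ 2 + e * n ^ 2 ≠ 0 := by
    rintro h0; rw [h0, zero_mul] at h; exact mul_ne_zero hx hy h
  have hx' : x = (m ^ 2 + e * n ^ 2) * (u ^ 2 + d * e * v ^ 2) / y := by
    rw [← h]; field_simp
  set g := m ^ 2 + e * n ^ 2 with hgdef
  refine gramSimilar_of_congr (c := g)
    (T := !![m, -(e * n), 0, 0; n, m, 0, 0;
      0, 0, g / y * u, -(g / y * (d * e * v)); 0, 0, g / y * v, g / y * u]) hg ?_ ?_
  · simp [Fin.prod_univ_four, hd, he, hx]
  · ext i j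
    fin_cases i <;> fin_cases j <;>
      simp [Matrix.mul_apply, Fin.sum_univ_four, Matrix.diagonal_apply] <;>
      (try rw [hx']) <;> (try field_simp) <;> (try rw [hgdef]) <;> ring

/-- Bilinear form `⟨a, b, abd⟩` on `k³`. -/
def ternary {k : Type*} [Field k] (d a b : k) (x y : Fin 3 → k) : k :=
  a * x 0 * y 0 + b * x 1 * y 1 + a * b * d * x 2 * y 2

/-- Cross product attached to `ternary`. -/
def ternaryCross {k : Type*} [Field k] (d a b : k) (x y : Fin 3 → k) : Fin 3 → k :=
  ![d * b * (x 1 * y 2 - x 2 * y 1), d * a * (x 2 * y 0 - x 0 * y 2), x 0 * y 1 - x 1 * y 0]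

/-- Two orthogonal anisotropic vectors of `⟨a, b, abd⟩` complete to a diagonalization. -/
theorem gramSimilar_normalGram {k : Type*} [Field k] {d a b e x : k} {w v : Fin 3 → k}
    (hd : d ≠ 0) (he : e ≠ 0) (hx : x ≠ 0) (hw : ternary d a b w w = e)
    (hv : ternary d a b v v = x) (hwv : ternary d a b w v = 0) :
    GramSimilar (diagonal ![1, e, x, d * e * x]) (normalGram d a b) := by
  have hu : ternary d a b (ternaryCross d a b w v) (ternaryCross d a b w v) = d * e * x := by
    have : ternary d a b (ternaryCross d a b w v) (ternaryCross d a b w v) =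
        d * (ternary d a b w w * ternary d a b v v - ternary d a b w v ^ 2) := by
      simp [ternary, ternaryCross]; ring
    rw [this, hw, hv, hwv]; ring
  have huw : ternary d a b (ternaryCross d a b w v) w = 0 := by
    simp [ternary, ternaryCross]; ring
  have huv : ternary d a b (ternaryCross d a b w v) v = 0 := by
    simp [ternary, ternaryCross]; ring
  set u := ternaryCross d a b w v
  simp only [ternary] at *
  refine gramSimilar_of_congr one_ne_zero
    (T := !![1, 0, 0, 0; 0, w 0, v 0, u 0; 0, w 1, v 1, u 1; 0, w 2, v 2, u 2]) ?_ ?_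
  · simp [Fin.prod_univ_four, hd, he, hx]
  · ext i j
    fin_cases i <;> fin_cases j <;>
      simp [normalGram, Matrix.mul_apply, Fin.sum_univ_four, Matrix.diagonal_apply] <;>
      first
        | linear_combination hw
        | linear_combination hv
        | linear_combination hu
        | linear_combination hwv
        | linear_combination huw
        | linear_combination huv

/-- An isotropic `⟨a, b, abd⟩` is isometric to `⟨1, -1, -d⟩`. -/
theorem gramSimilar_of_isotropic {k : Type*} [Field k] (h2 : (2 : k) ≠ 0) {d a b : k}
    (hd : d ≠ 0) (ha : a ≠ 0) (hb : b ≠ 0) {w : Fin 3 → k} (hw0 : w ≠ 0)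
    (hw : ternary d a b w w = 0) :
    GramSimilar (diagonal ![1, 1, -1, d * 1 * -1]) (normalGram d a b) := by
  obtain ⟨v, hv⟩ : ∃ v, ternary d a b w v ≠ 0 := by
    by_contra! h
    refine hw0 (funext fun i => ?_)
    have := h (Pi.single i 1)
    fin_cases i <;> simpa [ternary, ha, hb, hd] using this
  set β := ternary d a b w v with hβ
  set t := (1 - ternary d a b v v) / (2 * β) with ht
  have hv1 : ternary d a b (v + t • w) (v + t • w) = 1 := by
    have : ternary d a b (v + t • w) (v + t • w) =
        ternary d a b v v + 2 * t * β + t ^ 2 * ternary d a b w w := by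
      simp [ternary, hβ]; ring
    rw [this, hw, ht]; field_simp; ring
  have hwv1 : ternary d a b (v + t • w) w = β := by
    have : ternary d a b (v + t • w) w = β + t * ternary d a b w w := by
      simp [ternary, hβ]; ring
    rw [this, hw]; ring
  set f := v + t • w
  refine gramSimilar_normalGram (w := f) (v := f - β⁻¹ • w) hd one_ne_zero
    (neg_ne_zero.mpr one_ne_zero) hv1 ?_ ?_
  · have : ternary d a b (f - β⁻¹ • w) (f - β⁻¹ • w) = ternary d a b f f
        - 2 * β⁻¹ * ternary d a b f w + β⁻¹ ^ 2 * ternary d a b w w := by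
      simp [ternary]; ring
    rw [this, hv1, hwv1, hw]; field_simp; ring
  · have : ternary d a b f (f - β⁻¹ • w) = ternary d a b f f - β⁻¹ * ternary d a b f w := by
      simp [ternary]; ring
    rw [this, hv1, hwv1]; field_simp; ring

/-- A similarity of `⟨1, a, b, abd⟩` over a field where `d = s²` can be adjusted to an isometry
of the ternary parts, by a multiplication in a quaternion algebra. -/
theorem exists_ternary_isometry {K : Type*} [Field K] {d s a b a' b' : K} (hs0 : s ≠ 0)
    (hs : s ^ 2 = d) (h : GramSimilar (normalGram d a b) (normalGram d a' b')) :
    ∃ M : Matrix (Fin 3) (Fin 3) K,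
      Mᵀ * diagonal ![a', b', a' * b' * d] * M = diagonal ![a, b, a * b * d] := by
  obtain ⟨c, hc, T, -, e⟩ := h
  have hN : T 0 0 ^ 2 + a' * T 1 0 ^ 2 + b' * T 2 0 ^ 2 + a' * b' * d * T 3 0 ^ 2 = c := by
    have := congrFun (congrFun e 0) 0
    simp [normalGram, Matrix.mul_apply, Fin.sum_univ_four, Matrix.diagonal_apply] at this
    linear_combination this
  set y : Fin 4 → K := fun i => T i 0 with hy
  set L : Matrix (Fin 4) (Fin 4) K :=
    !![y 0, a' * y 1, b' * y 2, a' * b' * d * y 3;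
      -y 1, y 0, b' * s * y 3, -(b' * s * y 2);
      -y 2, -(a' * s * y 3), y 0, a' * s * y 1;
      -y 3, s⁻¹ * y 2, -(s⁻¹ * y 1), y 0] with hL
  change y 0 ^ 2 + a' * y 1 ^ 2 + b' * y 2 ^ 2 + a' * b' * d * y 3 ^ 2 = c at hN
  have hLD : Lᵀ * normalGram d a' b' * L = c • normalGram d a' b' := by
    rw [hL, ← hN]
    ext i j
    fin_cases i <;> fin_cases j <;>
      simp [normalGram, Matrix.mul_apply, Fin.sum_univ_four, Matrix.diagonal_apply, ← hs] <;>
      (try field_simp) <;> ring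
  have hLy : L *ᵥ y = c • Pi.single 0 1 := by
    rw [hL, ← hN]
    ext i
    fin_cases i <;> simp [Matrix.mulVec, dotProduct, Fin.sum_univ_four] <;> (try field_simp) <;>
      ring
  set N := c⁻¹ • (L * T) with hNdef
  have hND : Nᵀ * normalGram d a' b' * N = normalGram d a b := by
    have : (L * T)ᵀ * normalGram d a' b' * (L * T) = (c * c) • normalGram d a b := by
      calc _ = Tᵀ * (Lᵀ * normalGram d a' b' * L) * T := by
            simp only [transpose_mul, Matrix.mul_assoc]
        _ = _ := by rw [hLD, Matrix.mul_smul, Matrix.smul_mul, e, smul_smul]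
    rw [hNdef, transpose_smul, Matrix.smul_mul, Matrix.smul_mul, Matrix.mul_smul, this, smul_smul,
      smul_smul]
    field_simp
    simp
  have hN0 : ∀ i, N i 0 = (Pi.single 0 1 : Fin 4 → K) i := by
    intro i
    have h1 : (L * T) i 0 = (L *ᵥ y) i := rfl
    rw [hNdef, Matrix.smul_apply, h1, hLy]
    simp [hc]
  have hN1 : ∀ j : Fin 3, N 0 j.succ = 0 := by
    intro j
    have := congrFun (congrFun hND 0) j.succ
    rw [Matrix.mul_apply, Fin.sum_univ_four] at this
    simpa [normalGram, Matrix.mul_apply, Fin.sum_univ_four, Matrix.diagonal_apply, hN0,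
      (Fin.succ_ne_zero j).symm] using this
  refine ⟨N.submatrix Fin.succ Fin.succ, ?_⟩
  ext i j
  have h0 := congrFun (congrFun hND i.succ) j.succ
  rw [Matrix.mul_apply, Fin.sum_univ_succ] at h0
  simp only [normalGram, mul_diagonal, transpose_apply, hN1, zero_mul, zero_add] at h0
  rw [Matrix.mul_apply]
  simp only [mul_diagonal, transpose_apply, submatrix_apply]
  refine Eq.trans ?_ (h0.trans ?_)
  · rfl
  · simp [diagonal_apply]

/-- If `A + sB` is an isometry of ternary forms of discriminant `d = s²` then `B` is singular:
otherwise `A = CB` with `C` skew, so that `det (A + sB)` lies in `s k`. -/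
theorem det_eq_zero_of_isometry {k K : Type*} [Field k] [Field K] [Algebra k K]
    (h2 : (2 : k) ≠ 0) {d a b a' b' : k} {s : K} (hs : s ^ 2 = algebraMap k K d)
    (hind : ∀ x y : k, algebraMap k K x + algebraMap k K y * s = 0 → x = 0 ∧ y = 0)
    (hd : d ≠ 0) (ha : a ≠ 0) (hb : b ≠ 0) (ha' : a' ≠ 0) (hb' : b' ≠ 0)
    {A B : Matrix (Fin 3) (Fin 3) k}
    (h0 : Aᵀ * diagonal ![a', b', a' * b' * d] * A
      + d • (Bᵀ * diagonal ![a', b', a' * b' * d] * B) = diagonal ![a, b, a * b * d])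
    (h1 : Aᵀ * diagonal ![a', b', a' * b' * d] * B
      + Bᵀ * diagonal ![a', b', a' * b' * d] * A = 0) :
    B.det = 0 := by
  by_contra hB
  have hu : IsUnit B.det := isUnit_iff_ne_zero.mpr hB
  have hut : IsUnit Bᵀ.det := by rwa [det_transpose]
  set G := diagonal ![a', b', a' * b' * d] with hG
  obtain ⟨C, rfl⟩ : ∃ C, A = C * B := ⟨A * B⁻¹, by rw [nonsing_inv_mul_cancel_right _ _ hu]⟩
  have hC : Cᵀ * G + G * C = 0 := by
    have : Bᵀ * (Cᵀ * G + G * C) * B = 0 := by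
      rw [← h1, transpose_mul]; simp only [Matrix.mul_assoc, Matrix.mul_add, Matrix.add_mul]
    have := congrArg (fun X => Bᵀ⁻¹ * (X * B⁻¹)) this
    simpa only [Matrix.mul_assoc, mul_nonsing_inv B hu, Matrix.mul_one, Matrix.zero_mul,
      Matrix.mul_zero, nonsing_inv_mul_cancel_left _ _ hut] using this
  have hCe : ∀ i j, C j i * ![a', b', a' * b' * d] j + ![a', b', a' * b' * d] i * C i j = 0 := by
    intro i j
    simpa [hG] using congrFun (congrFun hC i) j
  have c00 : C 0 0 = 0 := by
    have h := hCe 0 0; simp at h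
    have : 2 * a' * C 0 0 = 0 := by linear_combination h
    simpa [h2, ha'] using this
  have c11 : C 1 1 = 0 := by
    have h := hCe 1 1; simp at h
    have : 2 * b' * C 1 1 = 0 := by linear_combination h
    simpa [h2, hb'] using this
  have c22 : C 2 2 = 0 := by
    have h := hCe 2 2; simp at h
    have : 2 * (a' * b' * d) * C 2 2 = 0 := by linear_combination h
    simpa [h2, hb', hd, ha'] using this
  have e01 := hCe 0 1
  have e02 := hCe 0 2
  have e12 := hCe 1 2
  simp at e01 e02 e12
  have f01 : C 0 1 = -(C 1 0 * b') / a' := by field_simp; linear_combination e01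
  have f02 : C 0 2 = -(C 2 0 * b' * d) := by
    have : a' * (C 0 2 + C 2 0 * b' * d) = 0 := by linear_combination e02
    linear_combination (mul_eq_zero.mp this).resolve_left ha'
  have f12 : C 1 2 = -(C 2 1 * a' * d) := by
    have : b' * (C 1 2 + C 2 1 * a' * d) = 0 := by linear_combination e12
    linear_combination (mul_eq_zero.mp this).resolve_left hb'
  have hGram : Bᵀ * (Cᵀ * G * C + d • G) * B = diagonal ![a, b, a * b * d] := by
    rw [← h0, transpose_mul]
    simp only [Matrix.mul_assoc, Matrix.mul_add, Matrix.add_mul, Matrix.mul_smul, Matrix.smul_mul]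
  have hdet := congrArg det hGram
  rw [det_mul, det_mul, det_transpose] at hdet
  have hdet2 : (Cᵀ * G * C + d • G).det = d * (a' * b' *
      (d + C 1 0 ^ 2 * b' / a' + C 2 0 ^ 2 * b' * d + C 2 1 ^ 2 * a' * d)) ^ 2 * d := by
    rw [det_fin_three]
    simp [hG, Matrix.mul_apply, Fin.sum_univ_three, Matrix.diagonal_apply, c00, c11, c22, f01,
      f02, f12]
    field_simp
    ring
  rw [hdet2] at hdet
  simp [Fin.prod_univ_three] at hdet
  set m := a' * b' * (d + C 1 0 ^ 2 * b' / a' + C 2 0 ^ 2 * b' * d + C 2 1 ^ 2 * a' * d)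
  have hsq : d * (m * B.det) ^ 2 = (a * b) ^ 2 := by
    apply mul_right_cancel₀ hd
    linear_combination hdet
  have hs2 : (s * algebraMap k K (m * B.det)) ^ 2 = (algebraMap k K (a * b)) ^ 2 := by
    rw [mul_pow, hs, ← map_pow, ← map_mul, hsq, map_pow]
  rcases sq_eq_sq_iff_eq_or_eq_neg.mp hs2 with h | h
  · have := (hind (-(a * b)) (m * B.det) (by rw [map_neg]; linear_combination h)).1
    exact mul_ne_zero ha hb (neg_eq_zero.mp this)
  · exact mul_ne_zero ha hb (hind (a * b) (m * B.det) (by linear_combination h)).1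

theorem ternary_comm {k : Type*} [Field k] (d a b : k) (x y : Fin 3 → k) :
    ternary d a b x y = ternary d a b y x := by
  simp only [ternary]; ring

theorem ternary_eq_dotProduct {k : Type*} [Field k] (d a b : k) (x y : Fin 3 → k) :
    ternary d a b x y = x ⬝ᵥ diagonal ![a, b, a * b * d] *ᵥ y := by
  simp [ternary, dotProduct, mulVec_diagonal, Fin.sum_univ_three]; ring

theorem ternary_mulVec {k : Type*} [Field k] {d a b a' b' : k} {M : Matrix (Fin 3) (Fin 3) k}
    (hM : Mᵀ * diagonal ![a', b', a' * b' * d] * M = diagonal ![a, b, a * b * d])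
    (x y : Fin 3 → k) :
    ternary d a' b' (M *ᵥ x) (M *ᵥ y) = ternary d a b x y := by
  rw [ternary_eq_dotProduct, ternary_eq_dotProduct, ← hM, ← mulVec_mulVec, ← mulVec_mulVec,
    dotProduct_mulVec x, vecMul_transpose]

theorem map_ternary {k K : Type*} [Field k] [Field K] (f : k →+* K) (d a b : k)
    (x y : Fin 3 → k) :
    f (ternary d a b x y) = ternary (f d) (f a) (f b) (f ∘ x) (f ∘ y) := by
  simp [ternary]

/-- An anisotropic vector of `⟨a, b, abd⟩` has an anisotropic orthogonal vector. -/
theorem exists_orthogonal_ternary {k : Type*} [Field k] {d a b : k}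
    (ha : a ≠ 0) (hb : b ≠ 0) (h2 : (2 : k) ≠ 0) {w : Fin 3 → k}
    (hw : ternary d a b w w ≠ 0) :
    ∃ v, ternary d a b w v = 0 ∧ ternary d a b v v ≠ 0 := by
  by_contra! H
  set e := ternary d a b w w with he
  -- the projections to the orthogonal complement of `w` are all isotropic
  have hp : ∀ x y, e * ternary d a b x y = ternary d a b w x * ternary d a b w y := by
    have key : ∀ x, e * ternary d a b x x = ternary d a b w x ^ 2 := by
      intro x
      have h1 := H (e • x - ternary d a b w x • w) (by
        simp only [ternary, he, Pi.sub_apply, Pi.smul_apply, smul_eq_mul]; ring)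
      have h3 : e * (e * ternary d a b x x - ternary d a b w x ^ 2) = 0 := by
        rw [← h1]
        simp only [ternary, he, Pi.sub_apply, Pi.smul_apply, smul_eq_mul]; ring
      linear_combination (mul_eq_zero.mp h3).resolve_left hw
    intro x y
    have hadd : ∀ u x y, ternary d a b u (x + y) = ternary d a b u x + ternary d a b u y := by
      intro u x y; simp only [ternary, Pi.add_apply]; ring
    have h1 := key (x + y)
    rw [hadd w, hadd, ternary_comm d a b _ x, ternary_comm d a b _ y, hadd, hadd,
      ternary_comm d a b y x] at h1
    apply mul_left_cancel₀ h2
    linear_combination h1 - key x - key y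
  have p01 := hp (Pi.single 0 1) (Pi.single 1 1)
  have p00 := hp (Pi.single 0 1) (Pi.single 0 1)
  have p11 := hp (Pi.single 1 1) (Pi.single 1 1)
  simp [ternary, ha, hb] at p01 p00 p11
  rcases p01 with h | h <;> simp_all

/-- Two forms of shape `⟨1, a, b, abd⟩` that become similar over `k(√d)` are similar. -/
theorem normalGram_descent {k K : Type*} [Field k] [Field K] [Algebra k K]
    (h2 : (2 : k) ≠ 0) {d a b a' b' : k} {s : K} (hs : s ^ 2 = algebraMap k K d)
    (hspan : ∀ z : K, ∃ x y : k, z = algebraMap k K x + algebraMap k K y * s)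
    (hind : ∀ x y : k, algebraMap k K x + algebraMap k K y * s = 0 → x = 0 ∧ y = 0)
    (hd : d ≠ 0) (ha : a ≠ 0) (hb : b ≠ 0) (ha' : a' ≠ 0) (hb' : b' ≠ 0)
    (h : GramSimilar ((normalGram d a b).map (algebraMap k K))
      ((normalGram d a' b').map (algebraMap k K))) :
    GramSimilar (normalGram d a b) (normalGram d a' b') := by
  set f := algebraMap k K
  have hfd : f d ≠ 0 := by simpa using hd
  have hs0 : s ≠ 0 := by rintro rfl; exact hfd (by rw [← hs]; simp)
  have hmap : ∀ a b : k, (normalGram d a b).map f = normalGram (f d) (f a) (f b) := by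
    intro a b
    rw [normalGram, normalGram, diagonal_map (map_zero f)]
    congr 1
    ext i; fin_cases i <;> simp
  have hmap3 : ∀ a b : k, diagonal ![f a, f b, f a * f b * f d] =
      (diagonal ![a, b, a * b * d]).map f := by
    intro a b
    rw [diagonal_map (map_zero f)]
    congr 1
    ext i; fin_cases i <;> simp
  rw [hmap, hmap] at h
  obtain ⟨M, hM⟩ := exists_ternary_isometry hs0 hs h
  choose A B hAB using fun i j => hspan (M i j)
  set A : Matrix (Fin 3) (Fin 3) k := Matrix.of A
  set B : Matrix (Fin 3) (Fin 3) k := Matrix.of B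
  have hMAB : M = A.map f + s • B.map f := by
    ext i j; simp [hAB i j, A, B, mul_comm]
  have hsplit : ∀ i j,
      (Aᵀ * diagonal ![a', b', a' * b' * d] * A
        + d • (Bᵀ * diagonal ![a', b', a' * b' * d] * B) - diagonal ![a, b, a * b * d]) i j = 0 ∧
      (Aᵀ * diagonal ![a', b', a' * b' * d] * B
        + Bᵀ * diagonal ![a', b', a' * b' * d] * A) i j = 0 := by
    intro i j
    apply hind
    rw [hmap3, hmap3, hMAB] at hM
    have := congrFun (congrFun hM i) j
    simp only [Matrix.mul_apply, Fin.sum_univ_three, Matrix.sub_apply, Matrix.add_apply,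
      Matrix.smul_apply, Matrix.map_apply, Matrix.transpose_apply, smul_eq_mul, map_add, map_sub,
      map_mul, ← hs] at this ⊢
    linear_combination this
  have hBdet : B.det = 0 := det_eq_zero_of_isometry h2 hs hind hd ha hb ha' hb'
    (sub_eq_zero.mp (Matrix.ext fun i j => (hsplit i j).1)) (Matrix.ext fun i j => (hsplit i j).2)
  obtain ⟨w, hw0, hBw⟩ := exists_mulVec_eq_zero_iff.mpr hBdet
  have hMw : M *ᵥ (f ∘ w) = f ∘ (A *ᵥ w) := by
    have hB : (B.map f) *ᵥ (f ∘ w) = 0 := by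
      ext i; rw [← RingHom.map_mulVec, hBw]; simp
    rw [hMAB, add_mulVec, smul_mulVec, hB, smul_zero, add_zero]
    ext i; exact (RingHom.map_mulVec f A w i).symm
  have hww : ternary d a' b' (A *ᵥ w) (A *ᵥ w) = ternary d a b w w := by
    apply f.injective
    rw [map_ternary, map_ternary, ← hMw, ternary_mulVec hM]
  set w' := A *ᵥ w
  by_cases he : ternary d a b w w = 0
  · have hw'0 : w' ≠ 0 := by
      intro h0
      apply hw0
      have hz : ∀ x, ternary (f d) (f a) (f b) (f ∘ w) x = 0 := by
        intro x
        rw [← ternary_mulVec hM, hMw, h0]; simp [ternary]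
      ext i
      have := hz (Pi.single i 1)
      fin_cases i <;> simpa [ternary, ha, hb, hd] using this
    exact (gramSimilar_of_isotropic h2 hd ha hb hw0 he).symm.trans
      (gramSimilar_of_isotropic h2 hd ha' hb' hw'0 (hww.trans he))
  · obtain ⟨v, hwv, hx⟩ := exists_orthogonal_ternary ha hb h2 he
    obtain ⟨v', hwv', hy⟩ := exists_orthogonal_ternary ha' hb' h2 (hww ▸ he)
    have hq := gramSimilar_normalGram hd he hx rfl rfl hwv
    have hq' := gramSimilar_normalGram hd he hy hww rfl hwv'
    refine hq.symm.trans (GramSimilar.trans ?_ hq')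
    set e := ternary d a b w w with hedef
    set x := ternary d a b v v with hxdef
    set y := ternary d a' b' v' v' with hydef
    set z := M *ᵥ (f ∘ v)
    have hfe : f e ≠ 0 := by simpa using he
    have hzz : ternary (f d) (f a') (f b') z z = f x := by
      rw [ternary_mulVec hM, ← map_ternary]
    have hwz : ternary (f d) (f a') (f b') (f ∘ w') z = 0 := by
      rw [← hMw, ternary_mulVec hM, ← map_ternary, hwv, map_zero]
    have hfw : ternary (f d) (f a') (f b') (f ∘ w') (f ∘ w') = f e := by
      rw [← map_ternary, hww]
    have hfv : ternary (f d) (f a') (f b') (f ∘ v') (f ∘ v') = f y := by rw [← map_ternary]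
    have hfwv : ternary (f d) (f a') (f b') (f ∘ w') (f ∘ v') = 0 := by
      rw [← map_ternary, hwv', map_zero]
    have gram : ∀ (d a b : K) (w v z : Fin 3 → K),
        ternary d a b (ternaryCross d a b w v) z ^ 2 = d *
          (ternary d a b w w * (ternary d a b v v * ternary d a b z z - ternary d a b v z ^ 2)
          - ternary d a b w v * (ternary d a b w v * ternary d a b z z
            - ternary d a b v z * ternary d a b w z)
          + ternary d a b w z * (ternary d a b w v * ternary d a b v z
            - ternary d a b v v * ternary d a b w z)) := by
      intro d a b w v z
      simp [ternary, ternaryCross]; ring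
    have key := gram (f d) (f a') (f b') (f ∘ w') (f ∘ v') z
    rw [hfw, hfv, hfwv, hwz, hzz] at key
    set r := ternary (f d) (f a') (f b') (ternaryCross (f d) (f a') (f b') (f ∘ w') (f ∘ v')) z
    obtain ⟨m, n, u, t, hf⟩ := exists_norm_factorization (c := x * y) (e := e) h2 hs hspan hind he
      (p := ternary (f d) (f a') (f b') (f ∘ v') z) (r := r / (s * f e)) (by
        have : r ^ 2 = s ^ 2 * (f e * (f y * f x -
            ternary (f d) (f a') (f b') (f ∘ v') z ^ 2)) := by rw [hs]; linear_combination key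
        rw [div_pow, this, map_mul]
        field_simp
        ring)
    exact gramSimilar_of_norm_factorization hd he hx hy hf

theorem polar_eq_dotProduct {R : Type*} [CommRing R] {n : ℕ} (q : QuadraticForm R (Fin n → R))
    (x y : Fin n → R) : QuadraticMap.polar q x y = x ⬝ᵥ polarMatrix q *ᵥ y := by
  have : polarMatrix q = LinearMap.toMatrix₂' R q.polarBilin := by
    ext i j; simp [polarMatrix]
  rw [this, ← Matrix.toLinearMap₂'_apply', Matrix.toLinearMap₂'_toMatrix']
  rfl

theorem polarMatrix_extendQF {R : Type*} [CommRing R] {n : ℕ} (q : QuadraticForm R (Fin n → R))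
    (l : Type*) [CommRing l] [Algebra R l] :
    polarMatrix (extendQF q l) = (polarMatrix q).map (algebraMap R l) := by
  have hpolar : ∀ (M : Matrix (Fin n) (Fin n) l) (x y : Fin n → l),
      QuadraticMap.polar M.toQuadraticForm' x y = x ⬝ᵥ M *ᵥ y + y ⬝ᵥ M *ᵥ x := by
    intro M x y
    rw [Matrix.toQuadraticForm', LinearMap.BilinMap.polar_toQuadraticMap,
      Matrix.toLinearMap₂'_apply', Matrix.toLinearMap₂'_apply']
  ext i j
  have h1 : polarMatrix (extendQF q l) i j = algebraMap R l (coeffMatrix q i j)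
      + algebraMap R l (coeffMatrix q j i) := by
    simp only [polarMatrix, Matrix.of_apply]
    refine (hpolar _ _ _).trans ?_
    simp
  rw [h1, ← map_add, Matrix.map_apply]
  congr 1
  simp only [coeffMatrix, polarMatrix, Matrix.of_apply]
  rcases lt_trichotomy i j with h | h | h
  · simp [h, h.ne, h.ne', h.not_gt]
  · subst h
    simp [two_mul]
  · simp [h, h.ne, h.ne', h.not_gt, QuadraticMap.polar_comm _ (Pi.single j 1)]

theorem polarMatrix_congr {R : Type*} [CommRing R] {n : ℕ} {q q' : QuadraticForm R (Fin n → R)}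
    {T : Matrix (Fin n) (Fin n) R} (h : ∀ x, q' (T *ᵥ x) = q x) :
    Tᵀ * polarMatrix q' * T = polarMatrix q := by
  ext i j
  have h1 : QuadraticMap.polar q' (T *ᵥ Pi.single i 1) (T *ᵥ Pi.single j 1) =
      polarMatrix q i j := by
    simp only [polarMatrix, QuadraticMap.polar, ← Matrix.mulVec_add, h, Matrix.of_apply]
  rw [← h1, polar_eq_dotProduct, mulVec_single_one, mulVec_single_one, Matrix.mul_assoc]
  rfl

theorem exists_congr_of_equivalent {K : Type*} [Field K] {n : ℕ}
    {q q' : QuadraticForm K (Fin n → K)} (h : QuadraticMap.Equivalent q q') :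
    ∃ T : Matrix (Fin n) (Fin n) K, T.det ≠ 0 ∧ Tᵀ * polarMatrix q' * T = polarMatrix q := by
  obtain ⟨e⟩ := h
  refine ⟨LinearMap.toMatrix' e.toLinearEquiv.toLinearMap, ?_, polarMatrix_congr fun x => ?_⟩
  · rw [LinearMap.det_toMatrix']
    exact (LinearEquiv.isUnit_det' e.toLinearEquiv).ne_zero
  · rw [LinearMap.toMatrix'_mulVec]
    exact e.map_app x

theorem polarMatrix_smul {R : Type*} [CommRing R] {n : ℕ} (c : R)
    (q : QuadraticForm R (Fin n → R)) : polarMatrix (c • q) = c • polarMatrix q := by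
  ext i j
  simp [polarMatrix, QuadraticMap.polar, mul_sub]

theorem SimilarQF.gramSimilar {K : Type*} [Field K] {n : ℕ} {q q' : QuadraticForm K (Fin n → K)}
    (h : SimilarQF q q') : GramSimilar (polarMatrix q) (polarMatrix q') := by
  obtain ⟨c, hc, h⟩ := h
  obtain ⟨T, hT, e⟩ := exists_congr_of_equivalent h
  exact ⟨c, hc.ne_zero, T, hT, by rw [e, polarMatrix_smul]⟩

theorem GramSimilar.similarQF {K : Type*} [Field K] (h2 : (2 : K) ≠ 0) {n : ℕ}
    {q q' : QuadraticForm K (Fin n → K)}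
    (h : GramSimilar (polarMatrix q) (polarMatrix q')) : SimilarQF q q' := by
  obtain ⟨c, hc, T, hT, e⟩ := h
  refine ⟨c, isUnit_iff_ne_zero.mpr hc,
    ⟨⟨T.toLinearEquiv' (T.invertibleOfIsUnitDet (isUnit_iff_ne_zero.mpr hT)), fun x => ?_⟩⟩⟩
  change q' (T *ᵥ x) = c * q x
  have hself : ∀ (q : QuadraticForm K (Fin n → K)) (x : Fin n → K),
      2 * q x = x ⬝ᵥ polarMatrix q *ᵥ x := by
    intro q x
    rw [← polar_eq_dotProduct, QuadraticMap.polar_self, two_nsmul, two_mul]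
  apply mul_left_cancel₀ h2
  rw [hself, mul_left_comm, hself, ← smul_eq_mul c, ← dotProduct_smul, ← Matrix.smul_mulVec, ← e,
    ← mulVec_mulVec, ← mulVec_mulVec, dotProduct_mulVec x, vecMul_transpose]

/-- A nondegenerate quaternary form with discriminant `d` is similar to some `⟨1, a, b, abd⟩`. -/
theorem exists_gramSimilar_normalGram {k : Type*} [Field k] (h2 : (2 : k) ≠ 0)
    (q : QuadraticForm k (Fin 4 → k)) {c d : k} (hc : c ≠ 0) (hd : d ≠ 0)
    (hdisc : discQF q = c ^ 2 * d) :
    ∃ a b : k, a ≠ 0 ∧ b ≠ 0 ∧ GramSimilar (normalGram d a b) (polarMatrix q) := by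
  have : Invertible (2 : k) := invertibleOfNonzero h2
  obtain ⟨w, hw⟩ : ∃ w : Fin 4 → k,
      QuadraticMap.Equivalent q (QuadraticMap.weightedSumSquares k w) := by
    have := QuadraticForm.equivalent_weightedSumSquares q
    rwa [Module.finrank_fin_fun] at this
  obtain ⟨F, hF, e⟩ := exists_congr_of_equivalent hw.symm
  have hdiag : polarMatrix (QuadraticMap.weightedSumSquares k w) =
      diagonal fun i => 2 * w i := by
    ext i j
    by_cases hij : i = j
    · subst hij
      simp [polarMatrix, QuadraticMap.weightedSumSquares_apply, Pi.single_apply]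
    · simp [polarMatrix, QuadraticMap.polar, QuadraticMap.weightedSumSquares_apply,
        Pi.single_apply, hij, mul_add, Finset.sum_add_distrib, Ne.symm hij]
  rw [hdiag] at e
  set y : Fin 4 → k := fun i => 2 * w i
  have hdet := congrArg det e
  rw [det_mul, det_mul, det_transpose, det_diagonal, Fin.prod_univ_four] at hdet
  change F.det * discQF q * F.det = _ at hdet
  rw [hdisc] at hdet
  have hne : y 0 * y 1 * y 2 * y 3 ≠ 0 := by
    rw [← hdet]; positivity
  have hy0 : y 0 ≠ 0 := by rintro h; simp [h] at hne
  have hy1 : y 1 ≠ 0 := by rintro h; simp [h] at hne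
  have hy2 : y 2 ≠ 0 := by rintro h; simp [h] at hne
  refine ⟨y 1 / y 0, y 2 / y 0, div_ne_zero hy1 hy0, div_ne_zero hy2 hy0, ?_⟩
  refine GramSimilar.trans (Q := diagonal y) ?_ ⟨1, one_ne_zero, F, hF, by rw [e, one_smul]⟩
  apply GramSimilar.symm
  refine gramSimilar_of_congr (c := (y 0)⁻¹)
    (T := diagonal ![1, 1, 1, F.det * c / (y 1 * y 2)]) (inv_ne_zero hy0) ?_ ?_
  · rwa [det_diagonal, Fin.prod_univ_four]
  · have hy3 : y 3 = F.det * (c ^ 2 * d) * F.det / (y 0 * y 1 * y 2) := by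
      rw [hdet]; field_simp
    ext i j
    by_cases hij : i = j
    · subst hij
      fin_cases i <;> simp [normalGram, hy0]
      · field_simp
      · field_simp
      · rw [hy3]; field_simp
    · simp [normalGram, hij]

theorem stmt_8 (k : Type u) [Field k] (h2 : (2 : k) ≠ 0)
    (q q' : QuadraticForm k (Fin 4 → k)) (hq : NondegQF q) (hq' : NondegQF q')
    (hd : ∃ c : k, c ≠ 0 ∧ discQF q' = c ^ 2 * discQF q)
    (hns : ¬IsSquare (discQF q))
    (hsim : SimilarQF
      (extendQF q (AdjoinRoot (Polynomial.X ^ 2 - Polynomial.C (discQF q))))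
      (extendQF q' (AdjoinRoot (Polynomial.X ^ 2 - Polynomial.C (discQF q))))) :
    SimilarQF q q' := by
  obtain ⟨c, hc, hcd⟩ := hd
  have hd0 : discQF q ≠ 0 := hq
  obtain ⟨a, b, ha, hb, hD⟩ := exists_gramSimilar_normalGram h2 q one_ne_zero hd0 (by simp)
  obtain ⟨a', b', ha', hb', hD'⟩ := exists_gramSimilar_normalGram h2 q' hc hd0 hcd
  generalize discQF q = d at *
  have hirr : Irreducible (Polynomial.X ^ 2 - Polynomial.C d) := by
    rw [Polynomial.irreducible_iff_roots_eq_zero_of_degree_le_three]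
    · rw [Multiset.eq_zero_iff_forall_notMem]
      intro x hx
      have := (Polynomial.mem_roots'.mp hx).2
      simp [sub_eq_zero] at this
      exact hns ⟨x, by rw [← this, sq]⟩
    · rw [Polynomial.natDegree_X_pow_sub_C]
    · rw [Polynomial.natDegree_X_pow_sub_C]; norm_num
  have : Fact (Irreducible (Polynomial.X ^ 2 - Polynomial.C d)) := ⟨hirr⟩
  have hs : (AdjoinRoot.root (Polynomial.X ^ 2 - Polynomial.C d)) ^ 2 = algebraMap k _ d := by
    have := AdjoinRoot.eval₂_root (Polynomial.X ^ 2 - Polynomial.C d)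
    simpa [sub_eq_zero] using this
  have hspan : ∀ z : AdjoinRoot (Polynomial.X ^ 2 - Polynomial.C d), ∃ x y : k,
      z = algebraMap k _ x + algebraMap k _ y * AdjoinRoot.root _ := by
    intro z
    induction z using AdjoinRoot.induction_on with
    | _ p =>
    have hm : (Polynomial.X ^ 2 - Polynomial.C d).Monic :=
      Polynomial.monic_X_pow_sub_C d two_ne_zero
    have hdeg : (p %ₘ (Polynomial.X ^ 2 - Polynomial.C d)).natDegree ≤ 1 := by
      have := Polynomial.natDegree_modByMonic_lt p hm (by
        intro h; have := congrArg Polynomial.natDegree h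
        rw [Polynomial.natDegree_X_pow_sub_C] at this; simp at this)
      rw [Polynomial.natDegree_X_pow_sub_C] at this
      omega
    obtain ⟨y, x, hxy⟩ := Polynomial.exists_eq_X_add_C_of_natDegree_le_one hdeg
    refine ⟨x, y, ?_⟩
    have h3 : AdjoinRoot.mk (Polynomial.X ^ 2 - Polynomial.C d) p =
        AdjoinRoot.mk _ (p %ₘ (Polynomial.X ^ 2 - Polynomial.C d)) := by
      conv_lhs => rw [← Polynomial.modByMonic_add_div p (Polynomial.X ^ 2 - Polynomial.C d)]
      rw [map_add, map_mul, AdjoinRoot.mk_self, zero_mul, add_zero]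
    rw [h3, hxy, map_add, map_mul, AdjoinRoot.mk_C, AdjoinRoot.mk_C, AdjoinRoot.mk_X, add_comm]
    rfl
  have hind : ∀ x y : k, algebraMap k (AdjoinRoot (Polynomial.X ^ 2 - Polynomial.C d)) x +
      algebraMap k _ y * AdjoinRoot.root _ = 0 → x = 0 ∧ y = 0 := by
    intro x y h
    have h3 : x ^ 2 = y ^ 2 * d := by
      apply (algebraMap k (AdjoinRoot (Polynomial.X ^ 2 - Polynomial.C d))).injective
      rw [map_mul, map_pow, map_pow, ← hs]
      linear_combination (algebraMap k _ x - algebraMap k _ y * AdjoinRoot.root _) * h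
    have hy : y = 0 := by
      by_contra hy
      exact hns ⟨x / y, by field_simp; linear_combination -h3⟩
    subst hy
    exact ⟨by simpa using h3, rfl⟩
  have hK := hsim.gramSimilar
  rw [polarMatrix_extendQF, polarMatrix_extendQF] at hK
  have hN := (hD.map (algebraMap k _)).trans (hK.trans (hD'.map (algebraMap k _)).symm)
  have := normalGram_descent h2 hs hspan hind hd0 ha hb ha' hb' hN
  exact (hD.symm.trans (this.trans hD')).similarQF h2

end
end

section
/- Let q be a nondegenerate quadratic form of rank 4 over a field k of characteristic ≠ 2, whose discriminant d = d(q) is not a square in k, and let l = k(√d). Then q is anisotropic over k if and only if the base change q_l is anisotropic over l. -/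
open scoped TensorProduct
open Quaternion
set_option synthInstance.maxHeartbeats 1000000
set_option maxHeartbeats 1000000
noncomputable section

universe u v

theorem extendQF_apply {R : Type*} [CommRing R] {n : ℕ} (q : QuadraticForm R (Fin n → R))
    (l : Type*) [CommRing l] [Algebra R l] (v : Fin n → l) :
    extendQF q l v = ∑ i, ∑ j, v i * v j * algebraMap R l (coeffMatrix q i j) := by
  change Matrix.toLinearMap₂' l ((coeffMatrix q).map (algebraMap R l)) v v = _
  simp [Matrix.toLinearMap₂'_apply, mul_assoc]

theorem apply_eq_sum_coeffMatrix {R : Type*} [CommRing R] {n : ℕ}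
    (q : QuadraticForm R (Fin n → R)) (x : Fin n → R) :
    q x = ∑ i, ∑ j, x i * x j * coeffMatrix q i j := by
  conv_lhs => rw [← q.toQuadraticMap_toBilin (Pi.basisFun R (Fin n))]
  rw [LinearMap.BilinMap.toQuadraticMap_apply,
    ← LinearMap.sum_repr_mul_repr_mul (Pi.basisFun R (Fin n)) (Pi.basisFun R (Fin n))]
  rw [Finsupp.sum_fintype _ _ (by simp)]
  refine Finset.sum_congr rfl fun i _ => ?_
  rw [Finsupp.sum_fintype _ _ (by simp)]
  refine Finset.sum_congr rfl fun j _ => ?_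
  rw [QuadraticMap.toBilin_apply]
  simp [coeffMatrix, mul_assoc]

/-- The base change of `q` at `x + r y`, where `x` and `y` have coordinates in the base ring. -/
theorem extendQF_add_mul {R : Type*} [CommRing R] {n : ℕ} (q : QuadraticForm R (Fin n → R))
    (l : Type*) [CommRing l] [Algebra R l] (x y : Fin n → R) (r : l) :
    extendQF q l (fun i => algebraMap R l (x i) + r * algebraMap R l (y i)) =
      algebraMap R l (q x) + r * algebraMap R l (QuadraticMap.polar q x y) +
        r ^ 2 * algebraMap R l (q y) := by
  rw [extendQF_apply]
  simp only [QuadraticMap.polar, apply_eq_sum_coeffMatrix, map_sub, map_sum,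
    map_mul, Pi.add_apply, map_add, ← Finset.sum_sub_distrib, Finset.mul_sum,
    ← Finset.sum_add_distrib]
  refine Finset.sum_congr rfl fun i _ => Finset.sum_congr rfl fun j _ => ?_
  ring

/-- The Gram determinant of a family of `n` vectors is the discriminant up to a square. -/
theorem det_polar_eq {R : Type*} [CommRing R] {n : ℕ} (q : QuadraticForm R (Fin n → R))
    (v : Fin n → Fin n → R) :
    (Matrix.of fun i j => QuadraticMap.polar q (v i) (v j)).det =
      (Matrix.of v).det ^ 2 * discQF q := by
  have h : (Matrix.of fun i j => QuadraticMap.polar q (v i) (v j)) =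
      Matrix.of v * polarMatrix q * (Matrix.of v).transpose := by
    have hB : polarMatrix q = LinearMap.toMatrix₂' R q.polarBilin := by
      ext i j
      simp [polarMatrix]
    rw [hB, LinearMap.mul_toMatrix₂'_mul]
    ext i j
    simp [LinearMap.toMatrix₂'_apply, Matrix.toLin'_apply, Matrix.col_def]
    rfl
  rw [h, Matrix.det_mul, Matrix.det_mul, Matrix.det_transpose, discQF]
  ring

/-- The orthogonal complement of two vectors in dimension four contains a plane. -/
theorem exists_linearIndependent_pair_polar_eq_zero {k : Type*} [Field k]
    (q : QuadraticForm k (Fin 4 → k)) (x y : Fin 4 → k) :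
    ∃ z w : Fin 4 → k, LinearIndependent k ![z, w] ∧
      (QuadraticMap.polar q x z = 0 ∧ QuadraticMap.polar q y z = 0) ∧
      QuadraticMap.polar q x w = 0 ∧ QuadraticMap.polar q y w = 0 := by
  let f : (Fin 4 → k) →ₗ[k] k × k := (q.polarBilin x).prod (q.polarBilin y)
  have hf := f.finrank_range_add_finrank_ker
  have hle : Module.finrank k f.range ≤ 2 := by
    simpa using f.range.finrank_le
  rw [Module.finrank_fin_fun] at hf
  have hker : 1 < Module.finrank k f.ker := by omega
  have := Module.nontrivial_of_finrank_pos (Nat.zero_lt_of_lt hker)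
  obtain ⟨z, hz⟩ := exists_ne (0 : f.ker)
  obtain ⟨w, hzw⟩ := exists_linearIndependent_pair_of_one_lt_finrank hker hz
  refine ⟨z, w, ?_, ?_, ?_⟩
  · rw [LinearIndependent.pair_iff] at hzw ⊢
    exact fun s t hst => hzw s t (Subtype.ext hst)
  · simpa [f] using z.2
  · simpa [f] using w.2

/-- A binary form whose discriminant is minus a square is isotropic. -/
theorem not_anisotropic_of_linearIndependent {k V : Type*} [Field k] [AddCommGroup V] [Module k V]
    (h2 : (2 : k) ≠ 0) (q : QuadraticForm k V) {z w : V} (hzw : LinearIndependent k ![z, w])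
    {s : k} (hs : QuadraticMap.polar q z w ^ 2 - 4 * q z * q w = s ^ 2) : ¬q.Anisotropic := by
  intro h
  have hz : q z ≠ 0 := fun h0 => hzw.ne_zero 0 (h z h0)
  set p := QuadraticMap.polar q z w with hp
  have h0 : q ((s - p) • z + (2 * q z) • w) = 0 := by
    rw [QuadraticMap.map_add q, QuadraticMap.map_smul, QuadraticMap.map_smul,
      QuadraticMap.polar_smul_left, QuadraticMap.polar_smul_right, ← hp]
    simp only [smul_eq_mul]
    linear_combination (-q z) * hs
  have := LinearIndependent.pair_iff.1 hzw _ _ (h _ h0)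
  exact mul_ne_zero h2 hz this.2

theorem AdjoinRoot.exists_eq_add_root_mul {R : Type*} [CommRing R] [Nontrivial R] (d : R)
    (v : AdjoinRoot (Polynomial.X ^ 2 - Polynomial.C d)) :
    ∃ a b : R, v = AdjoinRoot.of _ a + AdjoinRoot.root _ * AdjoinRoot.of _ b := by
  have hm : (Polynomial.X ^ 2 - Polynomial.C d).Monic := Polynomial.monic_X_pow_sub_C d two_ne_zero
  obtain ⟨p, rfl⟩ := AdjoinRoot.mk_surjective v
  have hdeg := Polynomial.natDegree_modByMonic_lt p hm
    (fun h => by simpa using congrArg Polynomial.natDegree h)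
  rw [Polynomial.natDegree_X_pow_sub_C] at hdeg
  obtain ⟨b, a, hab⟩ :=
    Polynomial.exists_eq_X_add_C_of_natDegree_le_one (Nat.lt_succ_iff.1 hdeg)
  refine ⟨a, b, ?_⟩
  have hp : AdjoinRoot.mk (Polynomial.X ^ 2 - Polynomial.C d) p =
      AdjoinRoot.mk _ (p %ₘ (Polynomial.X ^ 2 - Polynomial.C d)) := by
    conv_lhs => rw [← Polynomial.modByMonic_add_div p (Polynomial.X ^ 2 - Polynomial.C d)]
    simp
  rw [hp, hab]
  simp only [map_add, map_mul, AdjoinRoot.mk_C, AdjoinRoot.mk_X]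
  ring

theorem AdjoinRoot.add_root_mul_eq_zero {R : Type*} [CommRing R] [Nontrivial R] {d a b : R}
    (h : AdjoinRoot.of (Polynomial.X ^ 2 - Polynomial.C d) a +
      AdjoinRoot.root _ * AdjoinRoot.of _ b = 0) : a = 0 ∧ b = 0 := by
  have hm : (Polynomial.X ^ 2 - Polynomial.C d).Monic := Polynomial.monic_X_pow_sub_C d two_ne_zero
  have hmk : AdjoinRoot.mk (Polynomial.X ^ 2 - Polynomial.C d)
      (Polynomial.C b * Polynomial.X + Polynomial.C a) = 0 := by
    rw [← h]
    simp only [map_add, map_mul, AdjoinRoot.mk_C, AdjoinRoot.mk_X]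
    ring
  rw [AdjoinRoot.mk_eq_zero] at hmk
  have h0 : Polynomial.C b * Polynomial.X + Polynomial.C a = 0 := by
    by_contra hne
    refine hm.not_dvd_of_natDegree_lt hne ?_ hmk
    rw [Polynomial.natDegree_X_pow_sub_C]
    exact Polynomial.natDegree_linear_le.trans_lt one_lt_two
  exact ⟨by simpa using congrArg (Polynomial.coeff · 0) h0,
    by simpa using congrArg (Polynomial.coeff · 1) h0⟩

/-- A rank four form with nonzero orthogonal values `-d a` and `a`, where `d` is the discriminant,
is isotropic: the orthogonal complement of such a pair is a hyperbolic plane. -/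
theorem not_anisotropic_of_apply_eq {k : Type*} [Field k] (h2 : (2 : k) ≠ 0)
    (q : QuadraticForm k (Fin 4 → k)) (hq : NondegQF q) {x y : Fin 4 → k} (hy : q y ≠ 0)
    (hxy : QuadraticMap.polar q x y = 0) (hx : q x = -(discQF q * q y)) : ¬q.Anisotropic := by
  obtain ⟨z, w, hzw, ⟨hxz, hyz⟩, hxw, hyw⟩ := exists_linearIndependent_pair_polar_eq_zero q x y
  have hdet := det_polar_eq q ![x, y, z, w]
  set t := (Matrix.of ![x, y, z, w]).det
  refine not_anisotropic_of_linearIndependent h2 q hzw (s := t / (2 * q y)) ?_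
  have key : 4 * q x * q y * (4 * q z * q w - QuadraticMap.polar q z w ^ 2) =
      t ^ 2 * discQF q := by
    rw [← hdet]
    simp [Matrix.det_succ_row_zero, Fin.sum_univ_succ, Fin.succAbove, hxy, hxz, hyz, hxw, hyw,
      QuadraticMap.polar_self, QuadraticMap.polar_comm q y x, QuadraticMap.polar_comm q z x,
      QuadraticMap.polar_comm q z y, QuadraticMap.polar_comm q w x,
      QuadraticMap.polar_comm q w y, QuadraticMap.polar_comm q w z]
    ring
  rw [hx] at key
  rw [div_pow, eq_div_iff (pow_ne_zero 2 (mul_ne_zero h2 hy))]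
  refine mul_right_cancel₀ hq ?_
  linear_combination key

theorem stmt_9 (k : Type u) [Field k] (h2 : (2 : k) ≠ 0)
    (q : QuadraticForm k (Fin 4 → k)) (hq : NondegQF q)
    (hns : ¬IsSquare (discQF q)) :
    q.Anisotropic ↔
      (extendQF q (AdjoinRoot (Polynomial.X ^ 2 - Polynomial.C (discQF q)))).Anisotropic := by
  have hroot : AdjoinRoot.root (Polynomial.X ^ 2 - Polynomial.C (discQF q)) ^ 2 =
      AdjoinRoot.of _ (discQF q) := by
    have := AdjoinRoot.eval₂_root (Polynomial.X ^ 2 - Polynomial.C (discQF q))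
    simpa [sub_eq_zero] using this
  constructor
  · intro h v hv
    choose x y hxy using fun i => AdjoinRoot.exists_eq_add_root_mul (discQF q) (v i)
    obtain rfl : v = _ := funext hxy
    have hexp := extendQF_add_mul q (AdjoinRoot (Polynomial.X ^ 2 - Polynomial.C (discQF q))) x y
      (AdjoinRoot.root _)
    rw [AdjoinRoot.algebraMap_eq, hv, hroot] at hexp
    have hzero := AdjoinRoot.add_root_mul_eq_zero (d := discQF q)
      (a := q x + discQF q * q y) (b := QuadraticMap.polar q x y) (by
        rw [map_add, map_mul]
        linear_combination -hexp)
    by_cases hy : q y = 0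
    · have hx : q x = 0 := by simpa [hy] using hzero.1
      simp [h x hx, h y hy, funext_iff]
    · exact absurd h (not_anisotropic_of_apply_eq h2 q hq hy hzero.2 (by
        linear_combination hzero.1))
  · intro h x hx
    have hexp := extendQF_add_mul q (AdjoinRoot (Polynomial.X ^ 2 - Polynomial.C (discQF q))) x 0
      (AdjoinRoot.root _)
    rw [hx] at hexp
    have hv := h _ (hexp.trans (by simp [QuadraticMap.polar]))
    funext i
    exact (AdjoinRoot.add_root_mul_eq_zero (congrFun hv i)).1

end
end
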